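/- arXiv:2003.13040 — 11 statements merged into one kernel-verified Lean document; each statement's English description precedes it below -/
import Mathlib

section
/- Let p be a prime, R an integral domain in which p is not a zero divisor, and m ⊂ R a prime ideal with p ∈ m. If f = (f₁, f₂, …) ∈ W(R) satisfies f₁ ∉ m, then every ghost component gh_i(f) lies outside m (in particular gh_i(f) ≠ 0 for all i), and f is not a zero divisor in W(R). -/
namespace WittVector

theorem ghostComponent_eq_sum {p : ℕ} [Fact p.Prime] {R : Type*} [CommRing R]
    (n : ℕ) (x : WittVector p R) :
    ghostComponent n x =
      ∑ i ∈ Finset.range (n + 1), (p : R) ^ i * x.coeff i ^ p ^ (n - i) := by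
  rw [ghostComponent_apply, aeval_wittPolynomial]

theorem ghostComponent_mem_iff_coeff_zero_mem {p : ℕ} [Fact p.Prime] {R : Type*} [CommRing R]
    {I : Ideal R} [I.IsPrime] (hpI : (p : R) ∈ I) (n : ℕ) (x : WittVector p R) :
    ghostComponent n x ∈ I ↔ x.coeff 0 ∈ I := by
  have htail : ∑ i ∈ Finset.range n,
      (p : R) ^ (i + 1) * x.coeff (i + 1) ^ p ^ (n - (i + 1)) ∈ I :=
    I.sum_mem fun i _ => I.mul_mem_right _ (I.pow_mem_of_mem hpI _ i.succ_pos)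
  rw [ghostComponent_eq_sum, Finset.sum_range_succ', I.add_mem_iff_right htail, pow_zero,
    one_mul, Ideal.IsPrime.pow_mem_iff_mem ‹_› _ (pow_pos (Fact.out : p.Prime).pos _)]

theorem ghostMap_injective_of_mem_nonZeroDivisors {p : ℕ} [Fact p.Prime] {R : Type*}
    [CommRing R] (hp : (p : R) ∈ nonZeroDivisors R) :
    Function.Injective (ghostMap : WittVector p R →+* ℕ → R) := by
  rw [injective_iff_map_eq_zero]
  intro x hx
  ext n
  rw [zero_coeff]
  induction n using Nat.strong_induction_on with
  | _ n ih =>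
    have hn : ghostComponent n x = 0 := by rw [← ghostMap_apply, hx, Pi.zero_apply]
    have hlow : ∑ i ∈ Finset.range n, (p : R) ^ i * x.coeff i ^ p ^ (n - i) = 0 :=
      Finset.sum_eq_zero fun i hi => by
        rw [ih i (Finset.mem_range.mp hi),
          zero_pow (pow_ne_zero _ (Fact.out : p.Prime).ne_zero), mul_zero]
    rw [ghostComponent_eq_sum, Finset.sum_range_succ, hlow, zero_add, Nat.sub_self, pow_zero,
      pow_one] at hn
    exact (mul_left_mem_nonZeroDivisors_eq_zero_iff (pow_mem hp n)).mp hn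

theorem mem_nonZeroDivisors_of_ghostComponent {p : ℕ} [Fact p.Prime] {R : Type*}
    [CommRing R] (hp : (p : R) ∈ nonZeroDivisors R) {x : WittVector p R}
    (hx : ∀ n, ghostComponent n x ∈ nonZeroDivisors R) :
    x ∈ nonZeroDivisors (WittVector p R) := by
  rw [mem_nonZeroDivisors_iff_right]
  intro y hy
  refine (injective_iff_map_eq_zero _).mp (ghostMap_injective_of_mem_nonZeroDivisors hp) y
    (funext fun n => ?_)
  rw [ghostMap_apply, Pi.zero_apply, ← mul_right_mem_nonZeroDivisors_eq_zero_iff (hx n),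
    ← map_mul, hy, map_zero]

end WittVector


/-- Let `p` be a prime, `R` an integral domain in which `p` is not a
zero divisor, and `m ⊂ R` a prime ideal with `p ∈ m`.  If `f ∈ W(R)` has first
component `f.coeff 0 ∉ m`, then every ghost component of `f` lies outside `m`
(in particular is nonzero), and `f` is not a zero divisor in `W(R)`. -/
theorem ghostComponents_notMem_and_nonZeroDivisor
    (p : ℕ) [Fact p.Prime] (R : Type*) [CommRing R] [IsDomain R]
    (hp : (p : R) ∈ nonZeroDivisors R)
    (m : Ideal R) [m.IsPrime] (hpm : (p : R) ∈ m)
    (f : WittVector p R) (hf : f.coeff 0 ∉ m) :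
    (∀ i : ℕ, WittVector.ghostComponent i f ∉ m) ∧
    (∀ i : ℕ, WittVector.ghostComponent i f ≠ 0) ∧
    f ∈ nonZeroDivisors (WittVector p R) := by
  have hmem : ∀ i : ℕ, WittVector.ghostComponent i f ∉ m := fun i =>
    mt (WittVector.ghostComponent_mem_iff_coeff_zero_mem hpm i f).mp hf
  have hne : ∀ i : ℕ, WittVector.ghostComponent i f ≠ 0 := fun i =>
    (ne_of_mem_of_not_mem m.zero_mem (hmem i)).symm
  exact ⟨hmem, hne, WittVector.mem_nonZeroDivisors_of_ghostComponent hp fun i =>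
    mem_nonZeroDivisors_of_ne_zero (hne i)⟩
end

section
/- Let p be a prime and R a Noetherian integral domain which is flat over ℤ_p and which is complete and separated for the I-adic topology for some finitely generated ideal I of R containing p. Let M ⊂ W(R) be a maximal ideal containing the ideal I_R (kernel of the first-component projection W(R) → R), and let m ⊂ R be the maximal ideal M/I_R of R ≅ W(R)/I_R. Let R̂ be the m-adic completion of R. Then the natural ring homomorphism W(R) → W(R̂) induced by R → R̂ is injective, and it maps every element of W(R) ∖ M to a unit of W(R̂); consequently the induced homomorphism from the localization W(R)_M to W(R̂) is injective. -/
namespace WittVector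

variable {p : ℕ} [hp : Fact p.Prime] {S : Type*} [CommRing S]

theorem iterate_frobenius_iterate_verschiebung (x : WittVector p S) (n : ℕ) :
    frobenius^[n] (verschiebung^[n] x) = x * (p : WittVector p S) ^ n := by
  induction n generalizing x with
  | zero => simp
  | succ n ih =>
    rw [Function.iterate_succ_apply', Function.iterate_succ_apply, ih, map_mul,
      frobenius_verschiebung, map_pow, map_natCast, pow_succ', mul_assoc]

theorem truncate_eq_one_iff {n : ℕ} {x : WittVector p S} :
    truncate n x = 1 ↔ ∀ i < n, (x - 1).coeff i = 0 := by
  rw [← mem_ker_truncate, RingHom.mem_ker, map_sub, map_one, sub_eq_zero]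

theorem exists_truncate_succ_mul_eq_one_of_truncate_eq_one
    (hpS : (p : S) ∈ (⊥ : Ideal S).jacobson) {n : ℕ} (hn : n ≠ 0) {x : WittVector p S}
    (hx : truncate n x = 1) : ∃ v, truncate (n + 1) (x * v) = 1 := by
  obtain ⟨z, hz⟩ : ∃ z, x - 1 = verschiebung^[n] z :=
    ⟨_, eq_iterate_verschiebung (truncate_eq_one_iff.mp hx)⟩
  obtain ⟨s, hs⟩ := isUnit_iff_exists_inv.mp
    (Ideal.mem_jacobson_bot.mp (Ideal.pow_mem_of_mem _ hpS n hn.bot_lt) (z.coeff 0))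
  set T : WittVector p S := teichmuller p (-z.coeff 0 * s) with hT
  have key : x * (1 + verschiebung^[n] T) - 1 =
      verschiebung^[n] (z + T + z * (T * (p : WittVector p S) ^ n)) := by
    rw [iterate_map_add, iterate_map_add, ← iterate_frobenius_iterate_verschiebung,
      ← iterate_verschiebung_mul_left, ← hz]
    ring
  refine ⟨1 + verschiebung^[n] T, truncate_eq_one_iff.mpr fun i hi ↦ ?_⟩
  rw [key]
  obtain hi | rfl := Nat.lt_succ_iff_lt_or_eq.mp hi
  · exact iterate_verschiebung_coeff_eq_zero _ hi
  · have hcoeff := iterate_verschiebung_coeff (z + T + z * (T * (p : WittVector p S) ^ i)) i 0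
    rw [zero_add] at hcoeff
    rw [hcoeff, ← constantCoeff_apply]
    simp only [map_add, map_mul, map_pow, map_natCast, constantCoeff_apply, hT,
      teichmuller_coeff_zero]
    linear_combination (-z.coeff 0) * hs

theorem exists_truncate_mul_eq_one (hpS : (p : S) ∈ (⊥ : Ideal S).jacobson)
    {x : WittVector p S} (hx : IsUnit (x.coeff 0)) (n : ℕ) :
    ∃ u, truncate (n + 1) (x * u) = 1 := by
  induction n with
  | zero =>
    obtain ⟨s, hs⟩ := isUnit_iff_exists_inv.mp hx
    refine ⟨teichmuller p s, truncate_eq_one_iff.mpr fun i hi ↦ ?_⟩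
    obtain rfl : i = 0 := by lia
    rw [← constantCoeff_apply, map_sub, map_mul, map_one, constantCoeff_apply,
      constantCoeff_apply, teichmuller_coeff_zero, hs, sub_self]
  | succ n ih =>
    obtain ⟨u, hu⟩ := ih
    obtain ⟨v, hv⟩ := exists_truncate_succ_mul_eq_one_of_truncate_eq_one hpS n.succ_ne_zero hu
    exact ⟨u * v, by rwa [← mul_assoc]⟩

theorem eq_of_forall_truncate_eq {x y : WittVector p S}
    (h : ∀ n, truncate (n + 1) x = truncate (n + 1) y) : x = y := by
  ext n
  simpa [coeff_truncate] using congr_arg (TruncatedWittVector.coeff (Fin.last n)) (h n)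

/-- If `p` lies in the Jacobson radical of `S`, a Witt vector over `S` is a unit as soon as its
constant coefficient is. -/
theorem isUnit_of_isUnit_coeff_zero_of_mem_jacobson (hpS : (p : S) ∈ (⊥ : Ideal S).jacobson)
    {x : WittVector p S} (hx : IsUnit (x.coeff 0)) : IsUnit x := by
  choose u hu using exists_truncate_mul_eq_one hpS hx
  let y : WittVector p S := mk p fun n ↦ (u n).coeff n
  have hy (n : ℕ) : truncate (n + 1) y = truncate (n + 1) (u n) := by
    ext i
    rw [coeff_truncate, coeff_truncate, coeff_mk]
    have hin : (i : ℕ) + 1 ≤ n + 1 := i.isLt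
    have hn : truncate (i + 1) (x * u n) = 1 := by
      rw [← TruncatedWittVector.truncate_wittVector_truncate hin, hu n, map_one]
    have heq : truncate (i + 1) (u i) = truncate (i + 1) (u n) :=
      left_inv_eq_right_inv (by rw [mul_comm, ← map_mul, hu]) (by rw [← map_mul, hn])
    simpa [coeff_truncate] using congr_arg (TruncatedWittVector.coeff (Fin.last (i : ℕ))) heq
  refine isUnit_iff_exists_inv.mpr ⟨y, eq_of_forall_truncate_eq fun n ↦ ?_⟩
  rw [map_mul, hy, ← map_mul, hu, map_one]

end WittVector

namespace AdicCompletion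

variable {A : Type*} [CommRing A] {J : Ideal A}

theorem map_algebraMap_le_jacobson_bot (fg : J.FG) :
    J.map (algebraMap A (AdicCompletion J A)) ≤ (⊥ : Ideal (AdicCompletion J A)).jacobson :=
  have := isAdicComplete_self J fg
  IsAdicComplete.le_jacobson_bot _

theorem isUnit_algebraMap_of_isUnit_mk (fg : J.FG) {a : A} (ha : IsUnit (Ideal.Quotient.mk J a)) :
    IsUnit (algebraMap A (AdicCompletion J A) a) := by
  obtain ⟨b, hb⟩ := isUnit_iff_exists_inv.mp ha
  obtain ⟨b, rfl⟩ := Ideal.Quotient.mk_surjective b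
  have hab : a * b - 1 ∈ J := by
    rw [← Ideal.Quotient.eq_zero_iff_mem, map_sub, map_mul, hb, map_one, sub_self]
  have hunit := Ideal.mem_jacobson_bot.mp
    (map_algebraMap_le_jacobson_bot fg (Ideal.mem_map_of_mem _ hab)) 1
  rw [mul_one, map_sub, map_one, sub_add_cancel, map_mul] at hunit
  exact isUnit_of_mul_isUnit_left hunit

theorem algebraMap_injective_of_isDomain [IsDomain A] [IsNoetherianRing A] (hJ : J ≠ ⊤) :
    Function.Injective (algebraMap A (AdicCompletion J A)) := by
  refine (injective_iff_map_eq_zero _).mpr fun a ha ↦ ?_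
  rw [← Ideal.mem_bot, ← Ideal.iInf_pow_eq_bot_of_isDomain J hJ, Ideal.mem_iInf]
  intro n
  rw [← Ideal.Quotient.eq_zero_iff_mem, ← evalₐ_of]
  exact (congr_arg (evalₐ J n) ha).trans (_root_.map_zero _)

end AdicCompletion


/-- Let `R` be a Noetherian integral domain, flat over `ℤ_p`,
complete and separated for the `I`-adic topology for a finitely generated ideal
`I` containing `p`.  Let `M ⊂ W(R)` be a maximal ideal containing
`I_R = ker(W(R) → R)` and `m = M/I_R` the corresponding maximal ideal of `R`,
and let `R̂` be the `m`-adic completion of `R`.  Then `W(R) → W(R̂)` is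
injective, sends every element outside `M` to a unit, and hence the induced map
on the localization `W(R)_M` is injective. -/
theorem wittVector_map_to_completion_injective
    (p : ℕ) [Fact p.Prime]
    (R : Type*) [CommRing R] [IsDomain R] [IsNoetherianRing R]
    [Algebra ℤ_[p] R] [Module.Flat ℤ_[p] R]
    (I : Ideal R) (hIfg : I.FG) (hpI : (p : R) ∈ I) [IsAdicComplete I R]
    (M : Ideal (WittVector p R)) [M.IsMaximal]
    (hIRM : RingHom.ker (WittVector.constantCoeff : WittVector p R →+* R) ≤ M)
    (m : Ideal R)
    (hm : m = M.map (WittVector.constantCoeff : WittVector p R →+* R)) :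
    Function.Injective (WittVector.map (p := p) (algebraMap R (AdicCompletion m R))) ∧
    (∀ f : WittVector p R, f ∉ M →
      IsUnit (WittVector.map (p := p) (algebraMap R (AdicCompletion m R)) f)) ∧
    (∀ h : ∀ y : M.primeCompl,
        IsUnit (WittVector.map (p := p) (algebraMap R (AdicCompletion m R)) (y : WittVector p R)),
      Function.Injective
        (IsLocalization.lift (M := M.primeCompl) (S := Localization.AtPrime M) h :
          Localization.AtPrime M →+* WittVector p (AdicCompletion m R))) := by
  have hsurj := WittVector.constantCoeff_surjective (R := R) p
  have hmax : m.IsMaximal := hm ▸ Ideal.IsMaximal.map_of_surjective_of_ker_le hsurj hIRM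
  have hfg : m.FG := m.fg_of_isNoetherianRing
  have hpm : (p : R) ∈ m :=
    (IsAdicComplete.le_jacobson_bot I).trans (sInf_le ⟨bot_le, hmax⟩) hpI
  have hpJ : (p : AdicCompletion m R) ∈ (⊥ : Ideal (AdicCompletion m R)).jacobson := by
    simpa using AdicCompletion.map_algebraMap_le_jacobson_bot hfg (Ideal.mem_map_of_mem _ hpm)
  have hinj := WittVector.map_injective (p := p) _
    (AdicCompletion.algebraMap_injective_of_isDomain hmax.ne_top)
  refine ⟨hinj, fun f hf ↦ ?_, fun h ↦ ?_⟩
  · refine WittVector.isUnit_of_isUnit_coeff_zero_of_mem_jacobson hpJ ?_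
    rw [WittVector.map_coeff]
    have hfm : f.coeff 0 ∉ m := by
      rw [hm, ← WittVector.constantCoeff_apply, Ideal.mem_map_iff_of_surjective _ hsurj]
      rintro ⟨g, hg, hgf⟩
      refine hf ((Submodule.sub_mem_iff_left M hg).mp (hIRM ?_))
      rw [RingHom.mem_ker, map_sub, hgf, sub_self]
    let := Ideal.Quotient.field m
    exact AdicCompletion.isUnit_algebraMap_of_isUnit_mk hfg
      (isUnit_iff_ne_zero.mpr (mt Ideal.Quotient.eq_zero_iff_mem.mp hfm))
  · refine (IsLocalization.lift_injective_iff h).mpr fun x y ↦ ?_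
    refine ⟨fun hxy ↦ ?_, fun hxy ↦ congr_arg _ (hinj hxy)⟩
    simpa only [IsLocalization.lift_eq] using congr_arg (IsLocalization.lift h) hxy
end

section
/- Let p be a prime, R a commutative ring in which p is not a zero divisor, and (ξ_j : R → S_j)_{j ∈ J} a family of ring homomorphisms to commutative rings S_j in each of which p is not a zero divisor. Assume that for every x ∈ R and every integer a ≥ 0: if ξ_j(x) ∈ p^a·S_j for all j ∈ J, then x ∈ p^a·R. Then for every Witt vector g ∈ W(R) and every integer a ≥ 0: if the image W(ξ_j)(g) is divisible by p^a in W(S_j) for all j ∈ J, then g is divisible by p^a in W(R). -/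
namespace WittVector

variable {p : ℕ} {R : Type*} [Fact p.Prime] [CommRing R]

theorem verschiebung_shift_one {x : WittVector p R} (hx : x.coeff 0 = 0) :
    verschiebung (x.shift 1) = x := by
  simpa using (eq_iterate_verschiebung (n := 1) (x := x) (by simpa using hx)).symm

theorem teichmuller_coeff_zero_add_verschiebung_shift_one (x : WittVector p R) :
    teichmuller p (x.coeff 0) + verschiebung (x.shift 1) = x := by
  ext n
  rw [coeff_add_of_disjoint]
  · cases n with
    | zero => simp [teichmuller_coeff_zero]
    | succ n => simp [teichmuller_coeff_pos, shift_coeff, add_comm]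
  · intro n
    cases n with
    | zero => simp
    | succ n => simp [teichmuller_coeff_pos]

theorem natCast_pow_mul_verschiebung (a : ℕ) (x : WittVector p R) :
    (p : WittVector p R) ^ a * verschiebung x = verschiebung ((p : WittVector p R) ^ a * x) := by
  have h := map_nsmul (verschiebung : WittVector p R →+ WittVector p R) (p ^ a) x
  simpa only [nsmul_eq_mul, Nat.cast_pow] using h.symm

theorem natCast_pow_mul_coeff_zero (a : ℕ) (x : WittVector p R) :
    ((p : WittVector p R) ^ a * x).coeff 0 = (p : R) ^ a * x.coeff 0 := by
  have h := map_mul (constantCoeff : WittVector p R →+* R) ((p : WittVector p R) ^ a) x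
  rwa [map_pow, map_natCast] at h

theorem natCast_pow_dvd_of_dvd_verschiebung (hp : (p : R) ∈ nonZeroDivisors R) {a : ℕ}
    {x : WittVector p R} (h : (p : WittVector p R) ^ a ∣ verschiebung x) :
    (p : WittVector p R) ^ a ∣ x := by
  obtain ⟨m, hm⟩ := h
  have hm0 : m.coeff 0 = 0 := by
    have h0 : (p : R) ^ a * m.coeff 0 = 0 := by
      rw [← natCast_pow_mul_coeff_zero, ← hm, verschiebung_coeff_zero]
    exact (mul_left_mem_nonZeroDivisors_eq_zero_iff (pow_mem hp a)).1 h0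
  refine ⟨m.shift 1, verschiebung_injective p R ?_⟩
  rw [hm, ← natCast_pow_mul_verschiebung, verschiebung_shift_one hm0]

theorem eq_zero_of_eq_verschiebung_succ (d : ℕ → WittVector p R)
    (hd : ∀ n, d n = verschiebung (d (n + 1))) (n : ℕ) : d n = 0 := by
  ext i
  rw [zero_coeff]
  induction i generalizing n with
  | zero => rw [hd, verschiebung_coeff_zero]
  | succ i ih => rw [hd, verschiebung_coeff_add_one, ih]

/-- Divisibility by a power of `p` can be established by splitting off multiples of Teichmüller
representatives one coefficient at a time. -/
theorem natCast_pow_dvd_of_forall_exists_eq_add_verschiebung {a : ℕ} (P : WittVector p R → Prop)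
    (hP : ∀ x, P x → ∃ (u : R) (y : WittVector p R), P y ∧
      x = (p : WittVector p R) ^ a * teichmuller p u + verschiebung y)
    {g : WittVector p R} (hg : P g) : (p : WittVector p R) ^ a ∣ g := by
  have hP' (x : {x // P x}) : ∃ (u : R) (y : {x // P x}),
      (x : WittVector p R) = (p : WittVector p R) ^ a * teichmuller p u + verschiebung y.1 := by
    obtain ⟨u, y, hy, hxy⟩ := hP x x.2
    exact ⟨u, ⟨y, hy⟩, hxy⟩
  choose u y hxy using hP'
  obtain ⟨k, hk0, hk⟩ : ∃ k : ℕ → {x // P x}, k 0 = ⟨g, hg⟩ ∧ ∀ n, k (n + 1) = y (k n) :=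
    ⟨fun n => y^[n] ⟨g, hg⟩, rfl, fun n => Function.iterate_succ_apply' y n _⟩
  let h : ℕ → WittVector p R := fun n => mk p fun i => u (k (n + i))
  have hh (n : ℕ) : h n = teichmuller p (u (k n)) + verschiebung (h (n + 1)) := by
    have hshift : (h n).shift 1 = h (n + 1) := by
      ext i
      simp only [h, shift_coeff, coeff_mk, add_assoc]
    rw [← hshift]
    exact (teichmuller_coeff_zero_add_verschiebung_shift_one (h n)).symm
  have hd (n : ℕ) : (k n).1 - (p : WittVector p R) ^ a * h n =
      verschiebung ((k (n + 1)).1 - (p : WittVector p R) ^ a * h (n + 1)) := by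
    rw [hxy (k n), hk, hh n, map_sub, ← natCast_pow_mul_verschiebung, mul_add,
      add_sub_add_left_eq_sub]
  have h0 := eq_zero_of_eq_verschiebung_succ
    (fun n => (k n).1 - (p : WittVector p R) ^ a * h n) hd 0
  rw [hk0] at h0
  exact ⟨h 0, sub_eq_zero.1 h0⟩

end WittVector

/-- Let `p` be a prime, `R` a commutative ring in which `p` is not a
zero divisor, and `(ξ_j : R → S_j)` a family of ring homomorphisms to rings in
which `p` is not a zero divisor.  Assume `p^a`-divisibility in `R` can be tested
via the `ξ_j`.  Then `p^a`-divisibility in `W(R)` can be tested via the induced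
maps `W(ξ_j) : W(R) → W(S_j)`. -/
theorem wittVector_p_pow_divisibility_test
    (p : ℕ) [Fact p.Prime]
    (R : Type*) [CommRing R] (hpR : (p : R) ∈ nonZeroDivisors R)
    {J : Type*} (S : J → Type*) [∀ j, CommRing (S j)]
    (hpS : ∀ j, (p : S j) ∈ nonZeroDivisors (S j))
    (ξ : ∀ j, R →+* S j)
    (H : ∀ (x : R) (a : ℕ), (∀ j, (p : S j) ^ a ∣ ξ j x) → (p : R) ^ a ∣ x) :
    ∀ (g : WittVector p R) (a : ℕ),
      (∀ j, (p : WittVector p (S j)) ^ a ∣ WittVector.map (ξ j) g) →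
      (p : WittVector p R) ^ a ∣ g := by
  intro g a hg
  refine WittVector.natCast_pow_dvd_of_forall_exists_eq_add_verschiebung
    (fun x => ∀ j, (p : WittVector p (S j)) ^ a ∣ WittVector.map (ξ j) x) (fun x hx => ?_) hg
  obtain ⟨u, hu⟩ := H (x.coeff 0) a fun j => by
    obtain ⟨m, hm⟩ := hx j
    exact ⟨m.coeff 0, by
      rw [← WittVector.natCast_pow_mul_coeff_zero, ← hm, WittVector.map_coeff]⟩
  have h0 : (x - (p : WittVector p R) ^ a * WittVector.teichmuller p u).coeff 0 = 0 := by
    have h := map_sub (WittVector.constantCoeff : WittVector p R →+* R) x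
      ((p : WittVector p R) ^ a * WittVector.teichmuller p u)
    simpa only [WittVector.constantCoeff_apply, WittVector.natCast_pow_mul_coeff_zero,
      WittVector.teichmuller_coeff_zero, hu, sub_self] using h
  have hV := WittVector.verschiebung_shift_one h0
  refine ⟨u, _, fun j => WittVector.natCast_pow_dvd_of_dvd_verschiebung (hpS j) ?_,
    eq_add_of_sub_eq' hV.symm⟩
  rw [← WittVector.map_verschiebung, hV, map_sub, map_mul, map_pow, map_natCast]
  exact dvd_sub (hx j) (dvd_mul_right _ _)
end

section
/- Let p be a prime, k a perfect field of characteristic p, and W = W(k) the ring of p-typical Witt vectors of k. Let R be a complete Noetherian local normal domain, flat over ℤ_p, which is a W-algebra admitting an injective W-algebra homomorphism R₀ = W[[t₁, …, t_r]] → R making R a finite R₀-module. Suppose (f_n)_{n∈ℕ} is a sequence of elements of the maximal ideal m_R of R such that for every finite field extension F of Frac(W), with O_F the integral closure of W in F, and every W-algebra homomorphism ξ : R → O_F, the sequence (ξ(f_n))_n converges to 0 in the p-adic topology of O_F. Then (f_n)_n converges to 0 in the m_R-adic topology of R. -/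
universe u v

open Polynomial
open scoped nonZeroDivisors

/-- A primitive element of the extension of fraction fields can be chosen in `B` and with minimal
polynomial defined over `A`. -/
theorem exists_integral_primitive_element (A B K L : Type*) [CommRing A] [IsDomain A]
    [CommRing B] [IsDomain B] [Algebra A B] [FaithfulSMul A B] [Algebra.IsIntegral A B]
    [Field K] [Field L] [Algebra A K] [IsFractionRing A K] [Algebra B L] [IsFractionRing B L]
    [Algebra K L] [Algebra A L] [IsScalarTower A K L] [IsScalarTower A B L]
    [FiniteDimensional K L] [Algebra.IsSeparable K L] :
    ∃ (θ : B) (P : A[X]), P.Monic ∧ P.map (algebraMap A K) = minpoly K (algebraMap B L θ) ∧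
      IntermediateField.adjoin K {algebraMap B L θ} = ⊤ := by
  obtain ⟨θ₀, hθ₀⟩ := Field.exists_primitive_element K L
  have hint : IsIntegral K θ₀ := .of_finite K θ₀
  obtain ⟨⟨s, hs⟩, b, hb⟩ : ∃ s : A⁰, ∃ b : B, algebraMap B L b = (s : A) • θ₀ := by
    obtain ⟨⟨b, ⟨_, s, hs, rfl⟩⟩, h⟩ :=
      IsLocalization.surj (Algebra.algebraMapSubmonoid B A⁰) θ₀
    refine ⟨⟨s, hs⟩, b, ?_⟩
    rw [← h, Algebra.smul_def, mul_comm, IsScalarTower.algebraMap_apply A B L]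
  obtain ⟨⟨t, ht⟩, htQ⟩ := IsLocalization.exist_integer_multiples A⁰
    (Finset.range (minpoly K θ₀).natDegree) (minpoly K θ₀).coeff
  have hs0 : s ≠ 0 := nonZeroDivisors.ne_zero hs
  have ht0 : t ≠ 0 := nonZeroDivisors.ne_zero ht
  have hst : algebraMap A K (s * t) ≠ 0 := by
    simpa using ⟨hs0, ht0⟩
  have hθ : algebraMap B L (t • b) = algebraMap A K (s * t) • θ₀ := by
    rw [algebraMap_smul, mul_comm, mul_smul, ← hb, Algebra.smul_def, Algebra.smul_def, map_mul,
      ← IsScalarTower.algebraMap_apply A B L]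
  have hadj : IntermediateField.adjoin K {algebraMap B L (t • b)} = ⊤ := by
    rw [eq_top_iff, ← hθ₀, IntermediateField.adjoin_simple_le_iff]
    have h1 := IntermediateField.smul_mem _ (IntermediateField.mem_adjoin_simple_self K
      (algebraMap B L (t • b))) (x := (algebraMap A K (s * t))⁻¹)
    nth_rw 2 [hθ] at h1
    rwa [smul_smul, inv_mul_cancel₀ hst, one_smul] at h1
  have hmin : minpoly K (algebraMap B L (t • b)) =
      (minpoly K θ₀).scaleRoots (algebraMap A K (s * t)) := by
    symm
    refine eq_of_monic_of_dvd_of_natDegree_le (minpoly.monic (.of_finite K _)) ?_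
      (minpoly.dvd K _ ?_) ?_
    · exact (monic_scaleRoots_iff _).2 (minpoly.monic hint)
    · have := scaleRoots_aeval_eq_zero (r := algebraMap A K (s * t)) (minpoly.aeval K θ₀)
      rwa [hθ, Algebra.smul_def]
    · rw [natDegree_scaleRoots, (Field.primitive_element_iff_minpoly_natDegree_eq K _).1 hadj,
        (Field.primitive_element_iff_minpoly_natDegree_eq K _).1 hθ₀]
  have hlift : minpoly K (algebraMap B L (t • b)) ∈ lifts (algebraMap A K) := by
    rw [hmin, lifts_iff_coeff_lifts]
    intro n
    rw [coeff_scaleRoots]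
    rcases lt_trichotomy n (minpoly K θ₀).natDegree with h | h | h
    · obtain ⟨y, hy⟩ := htQ n (by simpa using h)
      obtain ⟨e, he⟩ := Nat.exists_eq_add_of_lt h
      refine ⟨y * s * (s * t) ^ e, ?_⟩
      have : (minpoly K θ₀).natDegree - n = e + 1 := by omega
      rw [this, map_mul, map_mul, hy]
      simp only [Algebra.smul_def, map_pow, map_mul]
      ring
    · subst h
      exact ⟨1, by simp [(minpoly.monic hint).leadingCoeff]⟩
    · exact ⟨0, by simp [coeff_eq_zero_of_natDegree_lt h]⟩
  obtain ⟨P, hP, -, hPm⟩ := lifts_and_natDegree_eq_and_monic hlift (minpoly.monic (.of_finite K _))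
  exact ⟨t • b, P, hPm, hP, hadj⟩

/-- A finite extension `B` of a domain `A` of characteristic zero is, after multiplication by some
`c ≠ 0`, contained in a simple extension `A[θ]` that becomes étale after inverting `c`. -/
theorem exists_generic_presentation (A : Type*) (B : Type*) [CommRing A] [IsDomain A] [CharZero A]
    [CommRing B] [IsDomain B] [Algebra A B] [Module.Finite A B] [FaithfulSMul A B] :
    ∃ (θ : B) (P : A[X]) (c : A), c ≠ 0 ∧ P.Monic ∧ (∀ q : A[X], aeval θ q = 0 → P ∣ q) ∧
      (∃ U V : A[X], U * P + V * derivative P = C c) ∧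
      ∀ b : B, ∃ q : A[X], q.degree < P.degree ∧ c • b = aeval θ q := by
  let K := FractionRing A
  let L := FractionRing B
  let : Algebra K L := FractionRing.liftAlgebra A L
  have : IsScalarTower A K L := FractionRing.isScalarTower_liftAlgebra A L
  have : CharZero K := charZero_of_injective_algebraMap (IsFractionRing.injective A K)
  have : Module.Finite K L := Module.Finite.of_isLocalization A B (Rₚ := K) (Sₚ := L) A⁰
  obtain ⟨θ, P, hPm, hP, hθ⟩ := exists_integral_primitive_element A B K L
  have hinj : Function.Injective (algebraMap A K) := IsFractionRing.injective A K
  have haev (q : A[X]) : aeval (algebraMap B L θ) (q.map (algebraMap A K)) =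
      algebraMap B L (aeval θ q) := by
    rw [aeval_map_algebraMap, aeval_algebraMap_apply]
  have haP : aeval θ P = 0 := by
    apply IsFractionRing.injective B L
    rw [← haev, hP, minpoly.aeval, map_zero]
  have hdvd (q : A[X]) (hq : aeval θ q = 0) : P ∣ q := by
    refine (map_dvd_map _ hinj hPm).1 ?_
    rw [hP]
    exact minpoly.dvd K _ (by rw [haev, hq, map_zero])
  obtain ⟨c₁, hc₁, U, V, hUV⟩ : ∃ c₁ : A, c₁ ≠ 0 ∧
      ∃ U V : A[X], U * P + V * derivative P = C c₁ := by
    have hsep : (P.map (algebraMap A K)).Separable := by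
      rw [hP]
      exact (minpoly.irreducible (.of_finite K _)).separable
    obtain ⟨U, V, h⟩ := hsep
    obtain ⟨b₁, hb₁, h₁⟩ := IsLocalization.integerNormalization_spec A⁰ U
    obtain ⟨b₂, hb₂, h₂⟩ := IsLocalization.integerNormalization_spec A⁰ V
    refine ⟨b₁ * b₂, mul_ne_zero (nonZeroDivisors.ne_zero hb₁) (nonZeroDivisors.ne_zero hb₂),
      C b₂ * IsLocalization.integerNormalization A⁰ U,
      C b₁ * IsLocalization.integerNormalization A⁰ V, ?_⟩
    apply map_injective _ hinj
    simp only [Polynomial.map_add, Polynomial.map_mul, map_C, h₁, h₂, map_mul]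
    rw [derivative_map] at h
    have e₁ (b : A) (U : K[X]) : b • U = C (algebraMap A K b) * U := by
      rw [← algebraMap_smul K b U, smul_eq_C_mul]
    rw [e₁, e₁]
    linear_combination C (algebraMap A K b₁) * C (algebraMap A K b₂) * h
  obtain ⟨c₂, hc₂, hc₂'⟩ : ∃ c₂ : A, c₂ ≠ 0 ∧ ∀ b : B, ∃ q : A[X], c₂ • b = aeval θ q := by
    set N : Submodule A B := LinearMap.range (aeval θ : A[X] →ₐ[A] B).toLinearMap
    have htors : Module.IsTorsion A (B ⧸ N) := by
      intro x
      obtain ⟨b, rfl⟩ := N.mkQ_surjective x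
      have hb : algebraMap B L b ∈ IntermediateField.adjoin K {algebraMap B L θ} := hθ ▸ trivial
      rw [← IntermediateField.mem_toSubalgebra,
        IntermediateField.adjoin_simple_toSubalgebra_of_isAlgebraic (.of_finite K _)] at hb
      obtain ⟨q, hq⟩ := (Algebra.adjoin_singleton_eq_range_aeval K (algebraMap B L θ)).le hb
      obtain ⟨c, hc, h⟩ := IsLocalization.integerNormalization_spec A⁰ q
      refine ⟨⟨c, hc⟩, ?_⟩
      rw [Submonoid.mk_smul, ← map_smul, Submodule.mkQ_apply, Submodule.Quotient.mk_eq_zero]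
      refine ⟨IsLocalization.integerNormalization A⁰ q, ?_⟩
      apply IsFractionRing.injective B L
      simp only [AlgHom.toLinearMap_apply]
      rw [← haev, h]
      change aeval (algebraMap B L θ) q = _ at hq
      rw [← algebraMap_smul K c q, map_smul, hq, algebraMap_smul, Algebra.smul_def,
        Algebra.smul_def, map_mul, ← IsScalarTower.algebraMap_apply A B L]
    obtain ⟨c, hc, hc0⟩ := Submodule.annihilator_top_inter_nonZeroDivisors htors
    refine ⟨c, nonZeroDivisors.ne_zero hc0, fun b ↦ ?_⟩
    have := (Submodule.mem_annihilator.1 hc) (N.mkQ b) trivial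
    rw [← map_smul, Submodule.mkQ_apply, Submodule.Quotient.mk_eq_zero] at this
    obtain ⟨q, hq⟩ := this
    exact ⟨q, hq.symm⟩
  refine ⟨θ, P, c₁ * c₂, mul_ne_zero hc₁ hc₂, hPm, hdvd, ⟨C c₂ * U, C c₂ * V, ?_⟩, fun b ↦ ?_⟩
  · rw [map_mul]
    linear_combination C c₂ * hUV
  · obtain ⟨q, hq⟩ := hc₂' (c₁ • b)
    refine ⟨q %ₘ P, degree_modByMonic_lt _ hPm, ?_⟩
    rw [mul_comm, mul_smul, hq]
    nth_rw 1 [← modByMonic_add_div q P]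
    simp [haP]

theorem exists_ringHom_of_root {A B F : Type*} [CommRing A] [CommRing B] [Algebra A B] [Field F]
    {θ : B} {P : A[X]} {c : A} (hdvd : ∀ q : A[X], aeval θ q = 0 → P ∣ q)
    (hspan : ∀ b : B, ∃ q : A[X], c • b = aeval θ q)
    (σ : A →+* F) (hc : σ c ≠ 0) {α : F} (hα : P.eval₂ σ α = 0) :
    ∃ ξ : B →+* F, (∀ a, ξ (algebraMap A B a) = σ a) ∧
      ∀ q : A[X], ξ (aeval θ q) = q.eval₂ σ α := by
  choose q hq using hspan
  have key {q₁ q₂ : A[X]} (h : aeval θ q₁ = aeval θ q₂) : q₁.eval₂ σ α = q₂.eval₂ σ α := by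
    obtain ⟨s, hs⟩ := hdvd (q₁ - q₂) (by rw [map_sub, h, sub_self])
    rw [← sub_eq_zero, ← eval₂_sub, hs, eval₂_mul, hα, zero_mul]
  have hval (q' : A[X]) : (q (aeval θ q')).eval₂ σ α / σ c = q'.eval₂ σ α := by
    rw [div_eq_iff hc, mul_comm, ← eval₂_C σ α (a := c), ← eval₂_mul]
    apply key
    rw [← hq, map_mul, aeval_C, Algebra.smul_def]
  refine ⟨{ toFun := fun b ↦ (q b).eval₂ σ α / σ c
            map_one' := ?_
            map_zero' := ?_
            map_mul' := ?_
            map_add' := ?_ }, fun a ↦ ?_, hval⟩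
  · simpa using hval 1
  · intro x y
    rw [div_mul_div_comm, div_eq_div_iff hc (mul_ne_zero hc hc), ← eval₂_mul,
      ← eval₂_C σ α (a := c), ← eval₂_mul, ← eval₂_mul, ← eval₂_mul]
    apply key
    simp only [map_mul, ← hq, aeval_C, Algebra.smul_def]
    ring
  · simpa using hval 0
  · intro x y
    rw [← add_div, ← eval₂_add]
    congr 1
    apply key
    simp only [map_add, ← hq, smul_add]
  · simpa using hval (C a)

open MvPowerSeries in
theorem MvPowerSeries.exists_algHom_eval_pow {W : Type*} [CommRing W] (π : W)
    [IsAdicComplete (Ideal.span {π}) W] {σ : Type*} [Fintype σ] (e : σ → ℕ) (he : ∀ i, e i ≠ 0) :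
    ∃ ξ : MvPowerSeries σ W →ₐ[W] W, ∀ (f : MvPowerSeries σ W) (N : ℕ) (T : Finset (σ →₀ ℕ)),
      (∀ ν ∉ T, N ≤ ∑ i, e i * ν i) →
        π ^ N ∣ ξ f - ∑ ν ∈ T, coeff ν f * π ^ (∑ i, e i * ν i) := by
  let : WithIdeal W := ⟨Ideal.span {π}⟩
  have hI : IsAdic (Ideal.span {π}) := rfl
  obtain ⟨_, _⟩ := hI.isAdicComplete_iff.1 ‹_›
  have ha : HasEval (fun i ↦ π ^ e i) := by
    refine ⟨fun i ↦ WithIdeal.isTopologicallyNilpotent_of_mem ?_, by simp⟩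
    exact Ideal.pow_mem_of_mem _ (Ideal.mem_span_singleton_self π) _ (Nat.pos_of_ne_zero (he i))
  refine ⟨aeval ha, fun f N T hT ↦ ?_⟩
  have hsum := hasSum_aeval ha f
  have hprod (ν : σ →₀ ℕ) : (ν.prod fun s n ↦ (π ^ e s) ^ n) = π ^ (∑ i, e i * ν i) := by
    rw [Finsupp.prod_fintype _ _ (by simp), ← Finset.prod_pow_eq_pow_sum]
    simp [pow_mul]
  simp only [hprod, smul_eq_mul] at hsum
  have hopen : IsOpen ((Ideal.span {π} ^ N : Ideal W) : Set W) := (isAdic_iff.1 hI).1 N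
  have hclosed : IsClosed ((Ideal.span {π} ^ N : Ideal W) : Set W) :=
    AddSubgroup.isClosed_of_isOpen (Submodule.toAddSubgroup (Ideal.span {π} ^ N)) hopen
  rw [← Ideal.mem_span_singleton, ← Ideal.span_singleton_pow]
  refine hclosed.mem_of_tendsto (hsum.sub_const _) ?_
  filter_upwards [Filter.eventually_ge_atTop T] with S hS
  rw [← Finset.sum_sdiff hS, add_sub_cancel_right]
  refine Ideal.sum_mem _ fun ν hν ↦ ?_
  rw [Ideal.span_singleton_pow]
  exact Ideal.mul_mem_left _ _ (Ideal.mem_span_singleton.2 (pow_dvd_pow _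
    (hT ν (Finset.mem_sdiff.1 hν).2)))

open MvPowerSeries in
theorem MvPowerSeries.eventually_dvd_coeff {W : Type*} [CommRing W] [IsDomain W] {π : W}
    (hπ : π ≠ 0) [IsAdicComplete (Ideal.span {π}) W] {r : ℕ} (g : ℕ → MvPowerSeries (Fin r) W)
    (hg : ∀ (ξ : MvPowerSeries (Fin r) W →ₐ[W] W) (a : ℕ), ∀ᶠ n in Filter.atTop, π ^ a ∣ ξ (g n))
    (ν : Fin r →₀ ℕ) (a : ℕ) : ∀ᶠ n in Filter.atTop, π ^ a ∣ coeff ν (g n) := by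
  classical
  obtain ⟨M, hM⟩ : ∃ M, ν.degree < M := ⟨_, Nat.lt_succ_self _⟩
  let d (μ : Fin r →₀ ℕ) : ℕ := ∑ i : Fin r, μ i * M ^ (i : ℕ)
  let w (μ : Fin r →₀ ℕ) : ℕ := ∑ i : Fin r, (M ^ r + M ^ (i : ℕ)) * μ i
  have hw (μ) : w μ = M ^ r * μ.degree + d μ := by
    simp only [w, d, Finsupp.degree_eq_sum, Finset.mul_sum, ← Finset.sum_add_distrib]
    exact Finset.sum_congr rfl fun i _ ↦ by ring
  have hlt {μ : Fin r →₀ ℕ} (h : μ.degree < M) (i) : μ i < M := (Finsupp.le_degree i μ).trans_lt h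
  have hd {μ : Fin r →₀ ℕ} (h : μ.degree < M) : d μ < M ^ r := by
    simpa [finFunctionFinEquiv_apply] using
      (finFunctionFinEquiv (fun i ↦ (⟨μ i, hlt h i⟩ : Fin M))).isLt
  have hd_inj {μ μ' : Fin r →₀ ℕ} (h : μ.degree < M) (h' : μ'.degree < M) (hh : d μ = d μ') :
      μ = μ' := by
    have := finFunctionFinEquiv.injective (a₁ := fun i ↦ (⟨μ i, hlt h i⟩ : Fin M))
      (a₂ := fun i ↦ (⟨μ' i, hlt h' i⟩ : Fin M)) (Fin.ext (by
        simpa [finFunctionFinEquiv_apply] using hh))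
    ext i
    simpa using congrFun this i
  have hw_inj {μ μ' : Fin r →₀ ℕ} (h : μ.degree < M) (h' : μ'.degree < M) (hh : w μ = w μ') :
      μ = μ' := by
    apply hd_inj h h'
    rw [hw, hw] at hh
    have h1 := congrArg (· % M ^ r) hh
    simpa [Nat.mod_eq_of_lt (hd h), Nat.mod_eq_of_lt (hd h')] using h1
  have hfin : {μ : Fin r →₀ ℕ | μ.degree < M}.Finite := Finsupp.finite_of_degree_lt M
  obtain ⟨s, hs⟩ : ∃ s, w ν = s := ⟨_, rfl⟩
  induction s using Nat.strong_induction_on generalizing ν a with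
  | _ s ih =>
  let T := hfin.toFinset.filter (fun μ ↦ w μ ≤ s)
  obtain ⟨ξ, hξ⟩ := exists_algHom_eval_pow π (fun i : Fin r ↦ (a + 1) * (M ^ r + M ^ (i : ℕ)))
    (fun i ↦ by
      have : 0 < M := by omega
      positivity)
  have hwt (μ : Fin r →₀ ℕ) : ∑ i : Fin r, (a + 1) * (M ^ r + M ^ (i : ℕ)) * μ i =
      (a + 1) * w μ := by
    simp only [w, Finset.mul_sum, mul_assoc]
  simp only [hwt] at hξ
  have hT (μ) (h : μ ∉ T) : (a + 1) * (s + 1) ≤ (a + 1) * w μ := by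
    apply Nat.mul_le_mul_left
    simp only [T, Finset.mem_filter, Set.Finite.mem_toFinset, Set.mem_ofPred_eq, not_and,
      not_le] at h
    by_cases hμ : μ.degree < M
    · exact h hμ
    · rw [← hs, hw, hw]
      have h1 : M ^ r * (ν.degree + 1) ≤ M ^ r * μ.degree := Nat.mul_le_mul_left _ (by omega)
      have := hd hM
      rw [mul_add] at h1
      omega
  have hνT : ν ∈ T := by simp [T, hM, hs]
  have hev : ∀ᶠ n in Filter.atTop, ∀ μ ∈ T.erase ν, π ^ ((a + 1) * (s + 1)) ∣ coeff μ (g n) := by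
    rw [Filter.eventually_all_finset]
    intro μ hμ
    simp only [T, Finset.mem_erase, Finset.mem_filter, Set.Finite.mem_toFinset,
      Set.mem_ofPred_eq] at hμ
    refine ih (w μ) (lt_of_le_of_ne hμ.2.2 fun h ↦ hμ.1 (hw_inj hμ.2.1 hM (h.trans hs.symm)))
      μ _ hμ.2.1 rfl
  filter_upwards [hev, hg ξ ((a + 1) * (s + 1))] with n h₁ h₂
  have h₃ := hξ (g n) _ T hT
  rw [← Finset.add_sum_erase _ _ hνT] at h₃
  have h₄ : π ^ ((a + 1) * (s + 1)) ∣ coeff ν (g n) * π ^ ((a + 1) * w ν) := by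
    have h₅ : π ^ ((a + 1) * (s + 1)) ∣ ∑ μ ∈ T.erase ν, coeff μ (g n) * π ^ ((a + 1) * w μ) :=
      Finset.dvd_sum fun μ hμ ↦ (h₁ μ hμ).mul_right _
    have := dvd_sub (dvd_sub h₂ h₃) h₅
    simpa using this
  rw [hs, mul_add, mul_one, pow_add, mul_comm (π ^ ((a + 1) * s))] at h₄
  exact (pow_dvd_pow π (Nat.le_succ a)).trans
    ((mul_dvd_mul_iff_right (pow_ne_zero _ hπ)).1 h₄)

open MvPowerSeries in
/-- A power series without terms of degree less than `a`, in finitely many variables, lies in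
the `a`-th power of the ideal generated by the variables. -/
theorem MvPowerSeries.mem_span_X_pow {W : Type*} [CommRing W] {σ : Type*} [Fintype σ] (a : ℕ)
    (f : MvPowerSeries σ W) (hf : ∀ ν : σ →₀ ℕ, ν.degree < a → coeff ν f = 0) :
    f ∈ Ideal.span (Set.range (X : σ → MvPowerSeries σ W)) ^ a := by
  classical
  induction a generalizing f with
  | zero => simp
  | succ a ih =>
  cases isEmpty_or_nonempty σ
  · have : f = 0 := by
      ext ν
      exact hf ν (by simp [Finsupp.degree_eq_sum])
    exact this ▸ zero_mem _
  have hex (ν : σ →₀ ℕ) : ∃ i, ν ≠ 0 → ν i ≠ 0 := by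
    by_cases h : ν = 0
    · exact ⟨Classical.arbitrary σ, fun h' ↦ absurd h h'⟩
    · obtain ⟨i, hi⟩ := Finsupp.ne_iff.1 h
      exact ⟨i, fun _ ↦ hi⟩
  choose j hj using hex
  let h (i : σ) : MvPowerSeries σ W := fun μ ↦
    if j (μ + .single i 1) = i then coeff (μ + .single i 1) f else 0
  have hh (i : σ) (μ) : coeff μ (h i) =
    if j (μ + .single i 1) = i then coeff (μ + .single i 1) f else 0 := rfl
  have hsum : f = ∑ i, X i * h i := by
    ext ν
    have hterm (i : σ) : coeff ν (X i * h i) = if i = j ν then coeff ν f else 0 := by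
      rw [X_def, coeff_monomial_mul, one_mul, hh]
      by_cases hi : Finsupp.single i 1 ≤ ν
      · rw [if_pos hi, tsub_add_cancel_of_le hi]
        simp only [eq_comm]
      · rw [if_neg hi]
        split_ifs with hij
        · have hν : ν = 0 := by
            by_contra hν
            apply hi
            rw [hij, Finsupp.single_le_iff]
            exact Nat.one_le_iff_ne_zero.2 (hj ν hν)
          exact (hf ν (by simp [hν])).symm
        · rfl
    rw [map_sum]
    simp [hterm]
  rw [hsum, pow_succ']
  refine Ideal.sum_mem _ fun i _ ↦ Ideal.mul_mem_mul (Ideal.subset_span ⟨i, rfl⟩) (ih _ ?_)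
  intro ν hν
  rw [hh]
  split_ifs
  · exact hf _ (by simpa using hν)
  · rfl

open MvPowerSeries in
theorem MvPowerSeries.eventually_mem_pow {W : Type*} [CommRing W] {π : W} {r : ℕ}
    (g : ℕ → MvPowerSeries (Fin r) W)
    (hg : ∀ ν a, ∀ᶠ n in Filter.atTop, π ^ a ∣ coeff ν (g n))
    (J : Ideal (MvPowerSeries (Fin r) W)) (hX : ∀ i, X i ∈ J) (hC : C π ∈ J) (a : ℕ) :
    ∀ᶠ n in Filter.atTop, g n ∈ J ^ a := by
  have hfin : {μ : Fin r →₀ ℕ | μ.degree < a}.Finite := Finsupp.finite_of_degree_lt a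
  have hev : ∀ᶠ n in Filter.atTop, ∀ μ ∈ hfin.toFinset, π ^ a ∣ coeff μ (g n) := by
    rw [Filter.eventually_all_finset]
    exact fun μ _ ↦ hg μ a
  filter_upwards [hev] with n hn
  rw [← sub_add_cancel (g n) (∑ μ ∈ hfin.toFinset, monomial μ (coeff μ (g n)))]
  refine Ideal.add_mem _ ?_ (Ideal.sum_mem _ fun μ hμ ↦ ?_)
  · refine Ideal.pow_right_mono (Ideal.span_le.2 (Set.range_subset_iff.2 hX)) a
      (mem_span_X_pow a _ fun ν hν ↦ ?_)
    classical
    rw [map_sub, map_sum]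
    simp [coeff_monomial, hν]
  · obtain ⟨y, hy⟩ := hn μ hμ
    have : monomial μ (coeff μ (g n)) = C π ^ a * monomial μ y := by
      rw [hy, ← map_pow, ← smul_eq_C_mul, ← map_smul, smul_eq_mul]
    rw [this]
    exact Ideal.mul_mem_right _ _ (Ideal.pow_mem_pow hC a)

theorem Polynomial.exists_dvd_mul_coeff_of_aeval {W K F : Type*} [CommRing W] [IsDomain W]
    [IsIntegrallyClosed W] [Field K] [Field F] [Algebra W K] [IsFractionRing W K] [Algebra K F]
    [Algebra W F] [IsScalarTower W K F] [Algebra.IsAlgebraic K F] (s : Finset F) :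
    ∃ D : W, D ≠ 0 ∧ ∀ (q : W[X]) (b : W), q.degree < s.card →
      (∀ α ∈ s, ∃ y : F, IsIntegral W y ∧ aeval α q = algebraMap W F b * y) →
        ∀ i, b ∣ D * q.coeff i := by
  classical
  have : FaithfulSMul W K := (faithfulSMul_iff_algebraMap_injective W K).2
    (IsFractionRing.injective W K)
  have : FaithfulSMul W F := .trans W K F
  have : Algebra.IsAlgebraic W F := (IsFractionRing.comap_isAlgebraic_iff (K := K)).2 ‹_›
  obtain ⟨D, hD, hint⟩ := Algebra.IsAlgebraic.exists_integral_multiples W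
    (Finset.image (fun x : F × ℕ ↦ (Lagrange.basis s id x.1).coeff x.2) (s ×ˢ Finset.range s.card))
  refine ⟨D, hD, fun q b hq h i ↦ ?_⟩
  by_cases hi : s.card ≤ i
  · rw [coeff_eq_zero_of_degree_lt (hq.trans_le (by exact_mod_cast hi)), mul_zero]
    exact dvd_zero b
  choose! y hy hqy using h
  have hinterp := Lagrange.eq_interpolate_of_eval_eq (f := q.map (algebraMap W F)) (v := id)
    (s := s) (fun α ↦ algebraMap W F b * y α) (Set.injOn_id _) (degree_map_le.trans_lt hq)
    fun α hα ↦ by rw [eval_map_algebraMap]; exact hqy α hα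
  have hcoeff := congrArg (coeff · i) hinterp
  simp only [coeff_map, Lagrange.interpolate_apply, finsetSum_coeff, coeff_C_mul] at hcoeff
  set z : F := ∑ α ∈ s, y α * (D • (Lagrange.basis s id α).coeff i) with hz
  have hzint : IsIntegral W z := by
    refine IsIntegral.sum _ fun α hα ↦ (hy α hα).mul (hint _ (Finset.mem_image.2 ⟨(α, i), ?_, rfl⟩))
    simpa using ⟨hα, not_le.1 hi⟩
  have hbz : algebraMap W F (D * q.coeff i) = algebraMap W F b * z := by
    rw [map_mul, hcoeff, hz, Finset.mul_sum, Finset.mul_sum]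
    refine Finset.sum_congr rfl fun α _ ↦ ?_
    rw [Algebra.smul_def]
    ring
  by_cases hb : b = 0
  · rw [hb, map_zero, zero_mul, FaithfulSMul.algebraMap_eq_zero_iff] at hbz
    rw [hbz]
    exact dvd_zero b
  have hb' : algebraMap W K b ≠ 0 := by simpa using hb
  have hzK : algebraMap K F (algebraMap W K (D * q.coeff i) / algebraMap W K b) = z := by
    rw [map_div₀, ← IsScalarTower.algebraMap_apply, ← IsScalarTower.algebraMap_apply, hbz,
      mul_div_cancel_left₀]
    simpa using hb
  rw [← hzK, isIntegral_algebraMap_iff (algebraMap K F).injective] at hzint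
  obtain ⟨x, hx⟩ := IsIntegrallyClosed.isIntegral_iff.1 hzint
  refine ⟨x, IsFractionRing.injective W K ?_⟩
  rw [map_mul (algebraMap W K) b, hx, mul_div_cancel₀ _ hb']

theorem Ideal.exists_mem_pow_of_mul_mem_pow {R : Type*} [CommRing R] [IsDomain R]
    [IsNoetherianRing R] (I : Ideal R) {c : R} (hc : c ≠ 0) (a : ℕ) :
    ∃ b : ℕ, ∀ x : R, c * x ∈ I ^ b → x ∈ I ^ a := by
  obtain ⟨k, hk⟩ := I.exists_pow_inf_eq_pow_smul (Ideal.span {c})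
  refine ⟨a + k, fun x hx ↦ ?_⟩
  have h : c * x ∈ I ^ (a + k) • ⊤ ⊓ Ideal.span {c} :=
    ⟨by simpa using hx, Ideal.mul_mem_right _ _ (Ideal.mem_span_singleton_self c)⟩
  rw [hk _ (Nat.le_add_left k a), Nat.add_sub_cancel] at h
  have h' : c * x ∈ I ^ a * Ideal.span {c} := Ideal.mul_mono_right inf_le_right h
  obtain ⟨y, hy, hxy⟩ := Ideal.mem_mul_span_singleton.1 h'
  rw [mul_comm] at hxy
  exact mul_left_cancel₀ hc hxy ▸ hy

theorem WittVector.charZero_of_perfect (p : ℕ) [Fact p.Prime] (k : Type*) [Field k] [CharP k p]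
    [PerfectRing k p] : CharZero (WittVector p k) := by
  obtain ⟨q, hq⟩ := CharP.exists (WittVector p k)
  rcases CharP.char_is_prime_or_zero (WittVector p k) q with h | rfl
  · have h0 : (q : WittVector p k) = 0 := CharP.cast_eq_zero _ q
    have h1 : (q : k) = 0 := by
      rw [← map_natCast (WittVector.constantCoeff (p := p) (R := k)) q, h0, map_zero]
    obtain rfl : p = q :=
      (Nat.prime_dvd_prime_iff_eq Fact.out h).1 ((CharP.cast_eq_zero_iff k p q).1 h1)
    exact absurd h0 (WittVector.irreducible p (k := k)).ne_zero
  · exact CharP.charP_to_charZero _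

/-- Let `θ` generate `B` over `A` up to the denominator `c`, and let `ξ₀` be a `W`-point of `A` at
which `c` does not vanish. If a sequence in `B` tends to zero at every point of `B` with values in
a suitable finite extension of `W`, then the images under `ξ₀` of its coordinates in the powers of
`θ` tend to zero. -/
theorem eventually_dvd_apply_coeff {W A B : Type*} [CommRing W] [IsDomain W]
    [IsDiscreteValuationRing W] [CommRing A] [CommRing B] [Algebra W A] [Algebra W B]
    [Algebra A B] [IsScalarTower W A B] [Algebra.IsIntegral A B] {π : W} (hπ : Irreducible π)
    {θ : B} {P U V : A[X]} {c : A} (hP : P.Monic)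
    (hdvd : ∀ q : A[X], aeval θ q = 0 → P ∣ q)
    (hsep : U * P + V * derivative P = C c)
    (hspan : ∀ b : B, ∃ q : A[X], c • b = aeval θ q)
    (f : ℕ → B) (q : ℕ → A[X]) (hdeg : ∀ n, (q n).degree < P.degree)
    (hq : ∀ n, c • f n = aeval θ (q n)) (ξ₀ : A →ₐ[W] W) (hc : ξ₀ c ≠ 0)
    (hconv : ∀ ξ : B →ₐ[W] integralClosure W
        (P.map ((algebraMap W (FractionRing W)).comp ξ₀.toRingHom)).SplittingField,
      ∀ a : ℕ, ∀ᶠ n in Filter.atTop, algebraMap W _ π ^ a ∣ ξ (f n)) (i a : ℕ) :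
    ∀ᶠ n in Filter.atTop, π ^ a ∣ ξ₀ ((q n).coeff i) := by
  classical
  set K := FractionRing W
  set Q : K[X] := P.map ((algebraMap W K).comp ξ₀.toRingHom) with hQ
  set F := Q.SplittingField
  let σ : A →+* F := (algebraMap W F).comp ξ₀.toRingHom
  have hWF : Function.Injective (algebraMap W F) := by
    rw [IsScalarTower.algebraMap_eq W K F]
    exact (algebraMap K F).injective.comp (IsFractionRing.injective W K)
  have hσc : σ c ≠ 0 := by simpa [σ] using hWF.ne hc
  have : Nontrivial A := ξ₀.toRingHom.domain_nontrivial
  have hQsep : Q.Separable := by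
    have hcK : algebraMap W K (ξ₀ c) ≠ 0 := by simpa using hc
    have := congrArg (Polynomial.map ((algebraMap W K).comp ξ₀.toRingHom)) hsep
    simp only [Polynomial.map_add, Polynomial.map_mul, map_C, ← derivative_map, ← hQ] at this
    refine ⟨C (algebraMap W K (ξ₀ c))⁻¹ * U.map ((algebraMap W K).comp ξ₀.toRingHom),
      C (algebraMap W K (ξ₀ c))⁻¹ * V.map ((algebraMap W K).comp ξ₀.toRingHom), ?_⟩
    rw [mul_assoc, mul_assoc, ← mul_add, this, ← C_mul]
    simp [inv_mul_cancel₀ hcK]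
  let s : Finset F := (Q.rootSet F).toFinset
  have hs : s.card = P.natDegree := by
    rw [Set.toFinset_card, card_rootSet_eq_natDegree hQsep (SplittingField.splits Q),
      hQ, hP.natDegree_map]
  obtain ⟨D, hD, hDq⟩ := exists_dvd_mul_coeff_of_aeval (W := W) (K := K) s
  obtain ⟨e, he⟩ := IsDiscreteValuationRing.associated_pow_irreducible hD hπ
  have hroot : ∀ α ∈ s, ∃ ξ : B →ₐ[W] integralClosure W F, ∀ q' : A[X],
      (ξ (aeval θ q') : F) = aeval α (q'.map ξ₀.toRingHom) ∧
      ∀ b : B, (ξ (c • b) : F) = algebraMap W F (ξ₀ c) * ξ b := by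
    intro α hα
    have hα' : P.eval₂ σ α = 0 := by
      have := (mem_rootSet.1 (Set.mem_toFinset.1 hα)).2
      have hσ : σ = (algebraMap K F).comp ((algebraMap W K).comp ξ₀.toRingHom) := by
        rw [← RingHom.comp_assoc, ← IsScalarTower.algebraMap_eq W K F]
      rw [hσ]
      exact (eval₂_map _ _ _).symm.trans this
    obtain ⟨ξ, hξA, hξ⟩ := exists_ringHom_of_root hdvd hspan σ hσc hα'
    let ξ' : B →ₐ[W] F :=
      { ξ with
        commutes' := fun w ↦ by
          change ξ (algebraMap W B w) = _
          rw [IsScalarTower.algebraMap_apply W A B, hξA]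
          simp [σ] }
    have hint (b : B) : ξ' b ∈ integralClosure W F := by
      obtain ⟨R, hR, hRb⟩ := Algebra.IsIntegral.isIntegral (R := A) b
      refine ⟨R.map ξ₀.toRingHom, hR.map _, ?_⟩
      have h₁ : (algebraMap W F).comp ξ₀.toRingHom = ξ.comp (algebraMap A B) :=
        RingHom.ext fun a ↦ (hξA a).symm
      rw [eval₂_map, h₁]
      change R.eval₂ _ (ξ b) = 0
      rw [← hom_eval₂, hRb, map_zero]
    refine ⟨ξ'.codRestrict _ hint, fun q' ↦ ⟨?_, fun b ↦ ?_⟩⟩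
    · change ξ (aeval θ q') = _
      rw [hξ, aeval_def, eval₂_map]
    · change ξ (c • b) = σ c * ξ b
      rw [Algebra.smul_def, map_mul, hξA]
  have hev : ∀ᶠ n in Filter.atTop, ∀ α ∈ s, ∃ y : F, IsIntegral W y ∧
      aeval α ((q n).map ξ₀.toRingHom) = algebraMap W F (π ^ (e + a)) * y := by
    rw [Filter.eventually_all_finset]
    intro α hα
    obtain ⟨ξ, hξ⟩ := hroot α hα
    filter_upwards [hconv ξ (e + a)] with n ⟨y, hy⟩
    refine ⟨algebraMap W F (ξ₀ c) * y, isIntegral_algebraMap.mul y.2, ?_⟩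
    rw [← (hξ (q n)).1, ← hq, (hξ (q n)).2, hy]
    change algebraMap W F (ξ₀ c) * (algebraMap W F π ^ (e + a) * (y : F)) = _
    rw [map_pow]
    ring
  filter_upwards [hev] with n hn
  have hdegn : ((q n).map ξ₀.toRingHom).degree < s.card := by
    rw [hs, ← degree_eq_natDegree hP.ne_zero]
    exact degree_map_le.trans_lt (hdeg n)
  have h := hDq _ _ hdegn hn i
  rw [coeff_map, pow_add] at h
  exact (mul_dvd_mul_iff_left (pow_ne_zero e hπ.ne_zero)).1
    (h.trans (mul_dvd_mul_right he.dvd _))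

/-- Let `k` be a perfect field of characteristic `p` and
`W = W(k)`.  Let `R` be a complete Noetherian local normal domain, flat over
`ℤ_p`, which is a `W`-algebra admitting an injective `W`-algebra homomorphism
`W[[t₁,…,t_r]] → R` making `R` a finite module over the power series ring.
If `(f_n)` is a sequence of elements of the maximal ideal `m_R` such that for
every finite extension `F` of `Frac(W)` and every `W`-algebra homomorphism
`ξ : R → O_F` (where `O_F` is the integral closure of `W` in `F`) the sequence
`(ξ(f_n))` converges to `0` `p`-adically, then `(f_n)` converges to `0` in the
`m_R`-adic topology. -/
theorem tendsto_zero_maximalIdeal_of_tendsto_zero_padic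
    (p : ℕ) [Fact p.Prime]
    (k : Type u) [Field k] [CharP k p]
    (hkperf : Function.Bijective (fun x : k => x ^ p))
    (R : Type v) [CommRing R] [IsNoetherianRing R] [IsLocalRing R]
    [IsAdicComplete (IsLocalRing.maximalIdeal R) R]
    [IsDomain R] [IsIntegrallyClosed R]
    [Algebra ℤ_[p] R] [Module.Flat ℤ_[p] R]
    [Algebra (WittVector p k) R]
    (r : ℕ)
    (φ : MvPowerSeries (Fin r) (WittVector p k) →ₐ[WittVector p k] R)
    (hφinj : Function.Injective φ)
    (hφfin : φ.toRingHom.Finite)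
    (f : ℕ → R) (hf : ∀ n, f n ∈ IsLocalRing.maximalIdeal R)
    (hconv : ∀ (F : Type u) [Field F]
      [Algebra (WittVector p k) F]
      [Algebra (FractionRing (WittVector p k)) F]
      [IsScalarTower (WittVector p k) (FractionRing (WittVector p k)) F]
      [FiniteDimensional (FractionRing (WittVector p k)) F]
      (ξ : R →ₐ[WittVector p k] integralClosure (WittVector p k) F),
      ∀ a : ℕ, ∃ N : ℕ, ∀ n ≥ N,
        (p : integralClosure (WittVector p k) F) ^ a ∣ ξ (f n)) :
    ∀ a : ℕ, ∃ N : ℕ, ∀ n ≥ N, f n ∈ IsLocalRing.maximalIdeal R ^ a := by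
  classical
  have : PerfectRing k p := ⟨hkperf⟩
  have : CharZero (WittVector p k) := WittVector.charZero_of_perfect p k
  have hp : Irreducible (p : WittVector p k) := WittVector.irreducible p
  let A := MvPowerSeries (Fin r) (WittVector p k)
  have : IsDomain A := NoZeroDivisors.to_isDomain A
  have : CharZero A := charZero_of_injective_ringHom (MvPowerSeries.C_injective (σ := Fin r))
  let : Algebra A R := φ.toRingHom.toAlgebra
  have : IsScalarTower (WittVector p k) A R := .of_algebraMap_eq fun w ↦ (φ.commutes w).symm
  have : Module.Finite A R := hφfin
  have : FaithfulSMul A R := (faithfulSMul_iff_algebraMap_injective A R).2 hφinj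
  obtain ⟨θ, P, c, hc, hP, hdvd, ⟨U, V, hsep⟩, hspan⟩ := exists_generic_presentation A R
  choose q hdeg hq using fun n ↦ hspan (f n)
  have hpt (ξ₀ : A →ₐ[WittVector p k] WittVector p k) (i a : ℕ) :
      ∀ᶠ n in Filter.atTop, (p : WittVector p k) ^ a ∣ ξ₀ (c * (q n).coeff i) := by
    by_cases hξc : ξ₀ c = 0
    · simp [hξc]
    filter_upwards [eventually_dvd_apply_coeff hp hP hdvd hsep
      (fun b ↦ (hspan b).imp fun _ h ↦ h.2) f q hdeg hq ξ₀ hξc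
      (fun ξ a ↦ by
        rw [map_natCast]
        exact Filter.eventually_atTop.2 (hconv _ ξ a)) i a] with n hn
    rw [map_mul]
    exact hn.mul_left _
  let J : Ideal A := (IsLocalRing.maximalIdeal R).comap (algebraMap A R)
  have hJ {x : A} (hx : ¬ IsUnit x) : x ∈ J := fun h ↦ hx (isUnit_of_map_unit (algebraMap A R) x h)
  have hJX (i : Fin r) : (MvPowerSeries.X i : A) ∈ J := hJ fun h ↦ by
    have h' := h.map (MvPowerSeries.constantCoeff (σ := Fin r) (R := WittVector p k))
    rw [MvPowerSeries.constantCoeff_X] at h'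
    exact not_isUnit_zero h'
  have hJC : (MvPowerSeries.C (p : WittVector p k) : A) ∈ J := hJ fun h ↦ hp.not_isUnit <| by
    simpa using h.map MvPowerSeries.constantCoeff
  intro a
  have hcR : algebraMap A R (c * c) ≠ 0 := by simpa using hc
  obtain ⟨b, hb⟩ := (IsLocalRing.maximalIdeal R).exists_mem_pow_of_mul_mem_pow hcR a
  have hev : ∀ᶠ n in Filter.atTop, ∀ i ∈ Finset.range (P.natDegree + 1),
      c * (q n).coeff i ∈ J ^ b := by
    rw [Filter.eventually_all_finset]
    exact fun i _ ↦ MvPowerSeries.eventually_mem_pow _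
      (fun ν a ↦ MvPowerSeries.eventually_dvd_coeff hp.ne_zero _ (fun ξ₀ a ↦ hpt ξ₀ i a) ν a)
      J hJX hJC b
  refine Filter.eventually_atTop.1 ?_
  filter_upwards [hev] with n hn
  refine hb _ ?_
  rw [map_mul, mul_assoc, ← Algebra.smul_def c (f n), hq,
    aeval_eq_sum_range' (Nat.lt_succ_of_le (natDegree_le_natDegree (hdeg n).le)), Finset.mul_sum]
  refine Ideal.sum_mem _ fun i hi ↦ ?_
  rw [Algebra.smul_def, ← mul_assoc, ← map_mul]
  refine Ideal.mul_mem_right _ _ ?_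
  exact Ideal.le_comap_pow (algebraMap A R) b (hn i hi)
end

section
/- Let K be an algebraically closed field, and let r ≥ 1 and N ≥ 1 be integers. Let (f_n)_{n∈ℕ} be a sequence of nonzero homogeneous polynomials of degree N in K[X₀, …, X_r]. Then there exists a point x ∈ K^{r+1} ∖ {0} such that f_n(x) ≠ 0 for infinitely many n; equivalently, after passing to a subsequence, there is a point of projective r-space over K not lying on any of the corresponding degree-N hypersurfaces. -/
/-- Over an algebraically closed field `K`, given a sequence of
nonzero homogeneous polynomials of degree `N ≥ 1` in `r + 1 ≥ 2` variables,
there is a nonzero point at which infinitely many of them do not vanish; i.e.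
a point of projective `r`-space avoiding infinitely many of the corresponding
degree-`N` hypersurfaces. -/
theorem exists_point_not_on_infinitely_many_hypersurfaces
    (K : Type*) [Field K] [IsAlgClosed K]
    (r N : ℕ) (hr : 1 ≤ r) (hN : 1 ≤ N)
    (f : ℕ → MvPolynomial (Fin (r + 1)) K)
    (hne : ∀ n, f n ≠ 0)
    (hhom : ∀ n, (f n).IsHomogeneous N) :
    ∃ x : Fin (r + 1) → K, x ≠ 0 ∧
      {n : ℕ | MvPolynomial.eval x (f n) ≠ 0}.Infinite := by
  obtain ⟨A, hA⟩ := Infinite.exists_subset_card_eq K (N + 1)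
  have hex : ∀ n, ∃ x ∈ Fintype.piFinset fun _ : Fin (r + 1) ↦ A,
      MvPolynomial.eval x (f n) ≠ 0 := by
    intro n
    by_contra! h
    refine hne n (MvPolynomial.eq_zero_of_eval_zero_at_prod_finset (f n) (fun _ ↦ A) ?_ ?_)
    · intro i
      have h₁ := MvPolynomial.degreeOf_le_totalDegree (f n) i
      have h₂ := (hhom n).totalDegree_le
      omega
    · intro x hx
      exact h x (Fintype.mem_piFinset.2 hx)
  have hinf : ∃ x : Fin (r + 1) → K, {n : ℕ | MvPolynomial.eval x (f n) ≠ 0}.Infinite := by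
    by_contra! h
    refine Set.infinite_univ (α := ℕ) (((Fintype.piFinset fun _ ↦ A).finite_toSet.biUnion
      fun x _ ↦ h x).subset fun n _ ↦ ?_)
    obtain ⟨x, hx, hxn⟩ := hex n
    exact Set.mem_biUnion (Finset.mem_coe.2 hx) hxn
  obtain ⟨x, hx⟩ := hinf
  refine ⟨x, ?_, hx⟩
  rintro rfl
  obtain ⟨n, hn⟩ := hx.nonempty
  refine hn ?_
  rw [MvPolynomial.eval_zero, MvPolynomial.constantCoeff_eq]
  exact (hhom n).coeff_eq_zero (by simp; omega)
end

section
/- Let p be a prime and let R be a complete Noetherian local normal domain, flat over ℤ_p, with p belonging to the maximal ideal of R. Fix an algebraic closure Ω of the fraction field of R, and let R̃ ⊆ Ω be the union of all subrings R′ with R ⊆ R′ ⊆ Ω such that R′ is a finite R-algebra, R′ is a normal domain, and R′[1/p] is finite étale over R[1/p] (this family is directed, so R̃ is a subring of Ω). Then: (i) there exists π ∈ R̃ with π^p = p; and (ii) for any such π, the Frobenius map R̃/πR̃ → R̃/pR̃ induced by x ↦ x^p is a well-defined ring isomorphism (bijective). -/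
universe u

set_option synthInstance.maxHeartbeats 1000000 in
/-- The condition on a subalgebra `A` of `Ω` over `R` expressing that `A` is a
finite normal `R`-subalgebra whose localization `A[1/p]` is finite étale over
`R[1/p]` (the structure map being the localization of `R → A` at `p`). -/
def IsFiniteNormalPEtaleSubalgebra (p : ℕ) (R : Type u) [CommRing R]
    (Ω : Type u) [CommRing Ω] [Algebra R Ω] (A : Subalgebra R Ω) : Prop :=
  Module.Finite R A ∧ IsDomain A ∧ IsIntegrallyClosed A ∧
    (letI : Algebra (Localization.Away ((p : R)))
        (Localization.Away (algebraMap R A (p : R))) :=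
      (Localization.awayMap (algebraMap R A) ((p : R))).toAlgebra
    Module.Finite (Localization.Away ((p : R)))
        (Localization.Away (algebraMap R A (p : R))) ∧
      Algebra.Etale (Localization.Away ((p : R)))
        (Localization.Away (algebraMap R A (p : R))))

section NormalBase

open TensorProduct

variable {S K : Type*} [CommRing S] [Field K] [Algebra S K] [IsFractionRing S K]

theorem exists_tmul_one_eq_of_isIntegral [IsIntegrallyClosed S] {E : Type*} [CommRing E]
    [Algebra S E] [Algebra.Smooth S E] {x : E ⊗[S] K} (hx : IsIntegral E x) :
    ∃ a : E, a ⊗ₜ[S] (1 : K) = x := by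
  obtain ⟨t, ht⟩ := (TensorProduct.toIntegralClosure_bijective_of_smooth
    (R := S) (S := E) (B := K)).2 ⟨x, hx⟩
  have key : ∀ t : E ⊗[S] integralClosure S K,
      ∃ a : E, a ⊗ₜ[S] (1 : K) = (TensorProduct.toIntegralClosure S E K t : E ⊗[S] K) := by
    intro t
    induction t with
    | zero => exact ⟨0, by simp⟩
    | add x y hx hy =>
      obtain ⟨a, ha⟩ := hx
      obtain ⟨b, hb⟩ := hy
      exact ⟨a + b, by rw [TensorProduct.add_tmul, ha, hb, map_add]; rfl⟩
    | tmul a k =>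
      obtain ⟨k, hk⟩ := k
      obtain ⟨s, rfl⟩ := IsIntegrallyClosed.isIntegral_iff.mp hk
      refine ⟨s • a, ?_⟩
      simp [TensorProduct.toIntegralClosure, Algebra.algebraMap_eq_smul_one,
        TensorProduct.smul_tmul]
  obtain ⟨a, ha⟩ := key t
  exact ⟨a, by rw [ha, ht]⟩

variable (K) in
theorem exists_includeRight_eq_of_isIdempotentElem [IsIntegrallyClosed S] {E : Type*} [CommRing E]
    [Algebra S E] [Algebra.Smooth S E] {x : K ⊗[S] E} (hx : IsIdempotentElem x) :
    ∃ a : E, (1 : K) ⊗ₜ[S] a = x := by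
  have : IsIntegral E (Algebra.TensorProduct.comm S K E x) := by
    refine ⟨.X ^ 2 - .X, by monicity!, ?_⟩
    have := congr(Algebra.TensorProduct.comm S K E $hx.eq)
    rw [map_mul] at this
    simp [pow_two, this]
  obtain ⟨a, ha⟩ := exists_tmul_one_eq_of_isIntegral this
  exact ⟨a, (Algebra.TensorProduct.comm S K E).injective (by simpa using ha)⟩

theorem isIdempotentElem_ker_of_field {A Ω : Type*} [CommRing A] [Algebra K A]
    [Algebra.Etale K A] [CommRing Ω] [Algebra K Ω] (φ : A →ₐ[K] Ω) :
    IsIdempotentElem (RingHom.ker φ.rangeRestrict) := by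
  let := φ.rangeRestrict.toAlgebra
  have : IsScalarTower K A φ.range := .of_algebraMap_eq' φ.rangeRestrict.comp_algebraMap.symm
  have hs : Function.Surjective φ.rangeRestrict := φ.rangeRestrict_surjective
  have := Algebra.FormallyUnramified.of_surjective φ.rangeRestrict hs
  have : Algebra.FiniteType K φ.range := .of_surjective φ.rangeRestrict hs
  have := Algebra.FormallyEtale.of_formallyUnramified_of_field K φ.range
  exact (Algebra.FormallyEtale.iff_of_surjective (R := A) (S := φ.range) hs).mp
    (.of_restrictScalars (R := K))

theorem exists_ker_eq_span_idempotent [IsDomain S] [IsIntegrallyClosed S] {E Ω : Type*} [CommRing E]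
    [Algebra S E] [Algebra.Etale S E] [Field Ω] [Algebra S Ω] [FaithfulSMul S Ω]
    (φ : E →ₐ[S] Ω) :
    ∃ e : E, IsIdempotentElem e ∧ RingHom.ker φ = Ideal.span {e} := by
  let K := FractionRing S
  let : Algebra K Ω := FractionRing.liftAlgebra S Ω
  have : IsScalarTower S K Ω := FractionRing.isScalarTower_liftAlgebra S Ω
  let ψ : K ⊗[S] E →ₐ[K] Ω :=
    Algebra.TensorProduct.lift (Algebra.ofId K Ω) φ fun _ _ ↦ Commute.all _ _
  have hψ (x : E) : ψ (1 ⊗ₜ x) = φ x := by simp [ψ]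
  have hfin : Module.Finite K (K ⊗[S] E) := Algebra.FormallyUnramified.finite_of_free K _
  have : IsNoetherianRing (K ⊗[S] E) := isNoetherian_of_tower K inferInstance
  obtain ⟨f, hf, hker⟩ := (Ideal.isIdempotentElem_iff_of_fg _ (IsNoetherian.noetherian _)).mp
    (isIdempotentElem_ker_of_field ψ)
  have hker' (x) : ψ x = 0 ↔ x ∈ Ideal.span {f} := by
    rw [← Ideal.submodule_span_eq, ← hker, RingHom.mem_ker, Subtype.ext_iff]; rfl
  have hinj : Function.Injective (fun x : E ↦ (1 : K) ⊗ₜ[S] x) :=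
    Algebra.TensorProduct.includeRight_injective (FaithfulSMul.algebraMap_injective S K)
  obtain ⟨e, he⟩ := exists_includeRight_eq_of_isIdempotentElem K hf
  refine ⟨e, hinj ?_, le_antisymm ?_ ?_⟩
  · simpa [← he] using hf.eq
  · intro x hx
    rw [RingHom.mem_ker] at hx
    have h1 : ψ (1 ⊗ₜ x) = 0 := (hψ x).trans hx
    obtain ⟨y, hy⟩ := Ideal.mem_span_singleton'.mp ((hker' _).mp h1)
    refine Ideal.mem_span_singleton'.mpr ⟨x, hinj ?_⟩
    have : (1 : K) ⊗ₜ[S] x * f = 1 ⊗ₜ x := by rw [← hy, mul_assoc, hf.eq]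
    simpa [← he] using this
  · rw [Ideal.span_singleton_le_iff_mem, RingHom.mem_ker, ← hψ, hker', he]
    exact Ideal.mem_span_singleton_self f

theorem etale_range [IsDomain S] [IsIntegrallyClosed S] {E Ω : Type*} [CommRing E]
    [Algebra S E] [Algebra.Etale S E] [Field Ω] [Algebra S Ω] [FaithfulSMul S Ω]
    (φ : E →ₐ[S] Ω) : Algebra.Etale S φ.range := by
  obtain ⟨e, he, hker⟩ := exists_ker_eq_span_idempotent φ
  let := φ.rangeRestrict.toAlgebra
  have : IsScalarTower S E φ.range := .of_algebraMap_eq' φ.rangeRestrict.comp_algebraMap.symm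
  have hs : Function.Surjective φ.rangeRestrict := φ.rangeRestrict_surjective
  have hker' : RingHom.ker φ.rangeRestrict = Ideal.span {e} := by
    rw [← hker]; ext x; simp [RingHom.mem_ker, Subtype.ext_iff]
  have hfg : (RingHom.ker φ.rangeRestrict).FG := ⟨{e}, by rw [hker']; simp⟩
  have : Algebra.FormallyEtale E φ.range :=
    (Algebra.FormallyEtale.iff_of_surjective (R := E) (S := φ.range) hs).mpr
      ((Ideal.isIdempotentElem_iff_of_fg _ hfg).mpr ⟨e, he, hker'⟩)
  have : Algebra.FormallyEtale S φ.range := .comp S E _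
  have : Algebra.FinitePresentation S φ.range := .of_surjective hs hfg
  exact {}

/-- A subalgebra of a field that is étale over a normal domain is integrally closed. -/
theorem mem_of_isIntegral_of_etale [IsDomain S] [IsIntegrallyClosed S] {Ω : Type*} [Field Ω]
    [Algebra S Ω] [FaithfulSMul S Ω] (T : Subalgebra S Ω) [Algebra.Etale S T]
    [Algebra.IsIntegral S T] {x b : Ω} (hx : IsIntegral T x) (hb : b ∈ T) (hb0 : b ≠ 0)
    (hxb : x * b ∈ T) : x ∈ T := by
  let K := FractionRing S
  let : Algebra K Ω := FractionRing.liftAlgebra S Ω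
  have : IsScalarTower S K Ω := FractionRing.isScalarTower_liftAlgebra S Ω
  let ψ : T ⊗[S] K →ₐ[T] Ω :=
    Algebra.TensorProduct.lift (Algebra.ofId T Ω) (IsScalarTower.toAlgHom S K Ω)
      fun _ _ ↦ Commute.all _ _
  have hψ (t : T) (k : K) : ψ (t ⊗ₜ k) = t * algebraMap K Ω k := by
    simp [ψ, Algebra.ofId_apply]
  have hrep (y : T ⊗[S] K) : ∃ (t : T) (s : S), s ≠ 0 ∧
      y = t ⊗ₜ (algebraMap S K s)⁻¹ := by
    induction y with
    | zero => exact ⟨0, 1, one_ne_zero, by simp⟩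
    | tmul t k =>
      obtain ⟨a, s, hs, rfl⟩ := IsFractionRing.div_surjective (A := S) k
      refine ⟨a • t, s, nonZeroDivisors.ne_zero hs, ?_⟩
      rw [TensorProduct.smul_tmul, Algebra.smul_def, div_eq_mul_inv]
    | add y z hy hz =>
      obtain ⟨t, s, hs, rfl⟩ := hy
      obtain ⟨t', s', hs', rfl⟩ := hz
      refine ⟨s' • t + s • t', s * s', mul_ne_zero hs hs', ?_⟩
      have h1 : algebraMap S K s ≠ 0 := by simpa using hs
      have h2 : algebraMap S K s' ≠ 0 := by simpa using hs'
      have h3 : s' • (algebraMap S K (s * s'))⁻¹ = (algebraMap S K s)⁻¹ := by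
        rw [Algebra.smul_def, map_mul, mul_inv_rev, mul_inv_cancel_left₀ h2]
      have h4 : s • (algebraMap S K (s * s'))⁻¹ = (algebraMap S K s')⁻¹ := by
        rw [Algebra.smul_def, map_mul, mul_inv, mul_inv_cancel_left₀ h1]
      rw [TensorProduct.add_tmul, TensorProduct.smul_tmul, TensorProduct.smul_tmul, h3, h4]
  have hinj : Function.Injective ψ := by
    rw [injective_iff_map_eq_zero]
    intro y hy
    obtain ⟨t, s, hs, rfl⟩ := hrep y
    rw [hψ, mul_eq_zero] at hy
    obtain h | h := hy
    · rw [show t = 0 from Subtype.ext h, TensorProduct.zero_tmul]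
    · simp [hs] at h
  obtain ⟨c, hc, s, hs, hcs⟩ : ∃ c ∈ T, ∃ s : S, s ≠ 0 ∧ b * c = algebraMap S Ω s := by
    have hb' : (⟨b, hb⟩ : T) ≠ 0 := fun h ↦ hb0 congr($h.1)
    obtain ⟨s, hs, h⟩ :=
      (Algebra.IsIntegral.isIntegral (R := S) (⟨b, hb⟩ : T)).isAlgebraic.exists_nonzero_dvd
        (mem_nonZeroDivisors_of_ne_zero hb')
    obtain ⟨c, hc⟩ := h
    exact ⟨c, c.2, s, hs, congr($hc.1).symm⟩
  have hs' : algebraMap S Ω s ≠ 0 := by simpa using hs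
  have hy : ψ (⟨x * b * c, mul_mem hxb hc⟩ ⊗ₜ (algebraMap S K s)⁻¹) = x := by
    rw [hψ, map_inv₀, ← IsScalarTower.algebraMap_apply, ← hcs]
    rw [← hcs] at hs'
    change x * b * c * (b * c)⁻¹ = x
    rw [mul_assoc x, mul_inv_cancel_right₀ hs']
  rw [← hy, isIntegral_algHom_iff ψ hinj] at hx
  obtain ⟨a, ha⟩ := exists_tmul_one_eq_of_isIntegral hx
  rw [← ha, hψ] at hy
  rw [← hy]
  simp

end NormalBase

section FiniteEtaleUnion

open TensorProduct

variable (S Ω : Type*) [CommRing S] [IsDomain S] [IsIntegrallyClosed S] [Field Ω] [Algebra S Ω]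
  [FaithfulSMul S Ω]

variable {S Ω} in
theorem finite_etale_sup (T T' : Subalgebra S Ω) [Module.Finite S T] [Module.Finite S T']
    [Algebra.Etale S T] [Algebra.Etale S T'] :
    Module.Finite S ↥(T ⊔ T') ∧ Algebra.Etale S ↥(T ⊔ T') := by
  let φ := Algebra.TensorProduct.productMap T.val T'.val
  have hφ : φ.range = T ⊔ T' := by
    rw [Algebra.TensorProduct.productMap_range, Subalgebra.range_val, Subalgebra.range_val]
  have : Algebra.Etale S (T ⊗[S] T') := .comp S T _
  rw [← hφ]
  exact ⟨.of_surjective φ.rangeRestrict.toLinearMap φ.rangeRestrict_surjective, etale_range φ⟩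

/-- The union of all finite étale `S`-subalgebras of `Ω`. -/
def finiteEtaleUnion : Subalgebra S Ω where
  carrier := {x | ∃ T : Subalgebra S Ω, Module.Finite S T ∧ Algebra.Etale S T ∧ x ∈ T}
  algebraMap_mem' s := ⟨⊥, inferInstance,
    .of_equiv (Algebra.botEquivOfInjective (FaithfulSMul.algebraMap_injective S Ω)).symm,
    algebraMap_mem _ s⟩
  add_mem' := by
    rintro x y ⟨T, _, _, hx⟩ ⟨T', _, _, hy⟩
    obtain ⟨h1, h2⟩ := finite_etale_sup T T'
    exact ⟨T ⊔ T', h1, h2, add_mem ((le_sup_left : T ≤ T ⊔ T') hx)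
      ((le_sup_right : T' ≤ T ⊔ T') hy)⟩
  mul_mem' := by
    rintro x y ⟨T, _, _, hx⟩ ⟨T', _, _, hy⟩
    obtain ⟨h1, h2⟩ := finite_etale_sup T T'
    exact ⟨T ⊔ T', h1, h2, mul_mem ((le_sup_left : T ≤ T ⊔ T') hx)
      ((le_sup_right : T' ≤ T ⊔ T') hy)⟩

variable {S Ω}

theorem mem_finiteEtaleUnion {x : Ω} : x ∈ finiteEtaleUnion S Ω ↔
    ∃ T : Subalgebra S Ω, Module.Finite S T ∧ Algebra.Etale S T ∧ x ∈ T := Iff.rfl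

theorem apply_mem_finiteEtaleUnion {E : Type*} [CommRing E] [Algebra S E] [Module.Finite S E]
    [Algebra.Etale S E] (φ : E →ₐ[S] Ω) (x : E) : φ x ∈ finiteEtaleUnion S Ω :=
  ⟨φ.range, .of_surjective φ.rangeRestrict.toLinearMap φ.rangeRestrict_surjective,
    etale_range φ, φ.mem_range_self x⟩

open Polynomial in
theorem etale_adjoinRoot_X_pow_sub_C {A : Type*} [CommRing A] {n : ℕ} (hn : n ≠ 0)
    (hn' : IsUnit (n : A)) {u : A} (hu : IsUnit u) :
    Algebra.Etale A (AdjoinRoot (X ^ n - C u)) := by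
  obtain ⟨v, hv⟩ := hn'.exists_right_inv
  obtain ⟨w, hw⟩ := hu.exists_right_inv
  let P : StandardEtalePair A :=
    { f := X ^ n - C u
      monic_f := monic_X_pow_sub_C u hn
      g := 1
      cond := by
        refine ⟨C (v * w) * X, - C w, 1, ?_⟩
        have h1 : C (n : A) * C v = 1 := by rw [← C_mul, hv, C_1]
        have h2 : C u * C w = 1 := by rw [← C_mul, hw, C_1]
        have h3 : (X : A[X]) ^ (n - 1) * X = X ^ n := pow_sub_one_mul hn X
        simp only [derivative_sub, derivative_X_pow, derivative_C, C_mul]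
        linear_combination X ^ n * C w * h1 + h2 + C (n : A) * C v * C w * h3 }
  have : IsLocalization.Away (AdjoinRoot.mk P.f P.g) (AdjoinRoot P.f) := by
    simp only [P, map_one]
    exact IsLocalization.away_of_isUnit_of_bijective _ isUnit_one Function.bijective_id
  exact .of_equiv (P.equivAwayAdjoinRoot.trans
    ((IsLocalization.algEquiv (.powers (AdjoinRoot.mk P.f P.g)) _ (AdjoinRoot P.f)).restrictScalars
      A))

open Polynomial in
theorem mem_finiteEtaleUnion_of_pow_eq {n : ℕ} (hn : n ≠ 0) (hn' : IsUnit (n : S)) {u v b : Ω}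
    (hu : u ∈ finiteEtaleUnion S Ω) (hv : v ∈ finiteEtaleUnion S Ω) (huv : u * v = 1)
    (hb : b ^ n = u) : b ∈ finiteEtaleUnion S Ω := by
  obtain ⟨T, _, _, hu⟩ := hu
  obtain ⟨T', _, _, hv⟩ := hv
  obtain ⟨_, _⟩ := finite_etale_sup T T'
  let A := T ⊔ T'
  let u' : A := ⟨u, (le_sup_left : T ≤ A) hu⟩
  let v' : A := ⟨v, (le_sup_right : T' ≤ A) hv⟩
  have hu' : IsUnit u' := .of_mul_eq_one v' (Subtype.ext huv)
  have hnA : IsUnit (n : A) := by simpa using hn'.map (algebraMap S A)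
  have := etale_adjoinRoot_X_pow_sub_C hn hnA hu'
  have : Module.Finite A (AdjoinRoot (X ^ n - C u')) :=
    (monic_X_pow_sub_C u' hn).finite_adjoinRoot
  have : Module.Finite S (AdjoinRoot (X ^ n - C u')) := .trans A _
  have : Algebra.Etale S (AdjoinRoot (X ^ n - C u')) := .comp S A _
  let φ : AdjoinRoot (X ^ n - C u') →ₐ[A] Ω :=
    AdjoinRoot.liftAlgHom _ (Algebra.ofId A Ω) b (by simp [hb, u'])
  have := apply_mem_finiteEtaleUnion (φ.restrictScalars S) (AdjoinRoot.root _)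
  simpa [φ] using this

end FiniteEtaleUnion

section Away

variable {R S Ω : Type*} [CommRing R] [CommRing S] [Field Ω]
  [Algebra R S] [Algebra R Ω] [Algebra S Ω] [IsScalarTower R S Ω]

theorem exists_pow_mul_mem_integralClosure (r : R) [IsLocalization.Away r S] {x : Ω}
    (hx : IsIntegral S x) : ∃ n : ℕ, IsIntegral R (algebraMap R Ω r ^ n * x) := by
  obtain ⟨⟨_, n, rfl⟩, h⟩ := hx.exists_multiple_integral_of_isLocalization (.powers r)
  refine ⟨n, ?_⟩
  rwa [Submonoid.smul_def, Algebra.smul_def, map_pow] at h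

theorem finite_inf_integralClosure [IsDomain R] [IsIntegrallyClosed R] [IsNoetherianRing R]
    [CharZero R] [FaithfulSMul R Ω] (r : R) [IsLocalization.Away r S]
    (T : Subalgebra S Ω) [Module.Finite S T] :
    Module.Finite R ↥(T.restrictScalars R ⊓ integralClosure R Ω) := by
  let K := FractionRing R
  have : CharZero K := charZero_of_injective_algebraMap (IsFractionRing.injective R K)
  let : Algebra K Ω := FractionRing.liftAlgebra R Ω
  have : IsScalarTower R K Ω := FractionRing.isScalarTower_liftAlgebra R Ω
  obtain ⟨s, hs⟩ := Subalgebra.fg_def.mp (Subalgebra.fg_of_fg_toSubmodule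
    (Module.Finite.iff_fg.mp ‹Module.Finite S T›))
  have : Finite s := hs.1
  let L := IntermediateField.adjoin K s
  have hSL (x : S) : algebraMap S Ω x ∈ L := by
    obtain ⟨n, a, h⟩ := IsLocalization.Away.surj r x
    have hr : IsUnit (algebraMap R Ω r) := by
      rw [IsScalarTower.algebraMap_apply R S Ω]
      exact (IsLocalization.Away.algebraMap_isUnit r).map _
    have h' := congr(algebraMap S Ω $h)
    simp only [map_mul, map_pow, ← IsScalarTower.algebraMap_apply] at h'
    rw [eq_div_of_mul_eq (pow_ne_zero n hr.ne_zero) h', IsScalarTower.algebraMap_apply R K Ω,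
      IsScalarTower.algebraMap_apply R K Ω, ← map_pow, ← map_div₀]
    exact L.algebraMap_mem _
  have hTL : ∀ x ∈ T, x ∈ L := by
    rw [← hs.2]
    intro x hx
    induction hx using Algebra.adjoin_induction with
    | mem x hx => exact IntermediateField.subset_adjoin K s hx
    | algebraMap x => exact hSL x
    | add x y _ _ hx hy => exact add_mem hx hy
    | mul x y _ _ hx hy => exact mul_mem hx hy
  have hint : ∀ x ∈ s, IsIntegral K x := by
    intro x hx
    have hxT : x ∈ T := hs.2 ▸ Algebra.subset_adjoin hx
    have h1 : IsIntegral S x :=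
      (Algebra.IsIntegral.isIntegral (R := S) (⟨x, hxT⟩ : T)).map T.val
    obtain ⟨n, hn⟩ := exists_pow_mul_mem_integralClosure r h1
    have hr := (IsLocalization.Away.algebraMap_isUnit (S := S) r).map (algebraMap S Ω)
    rw [← IsScalarTower.algebraMap_apply] at hr
    have h2 : algebraMap K Ω (algebraMap R K r ^ n)⁻¹ * (algebraMap R Ω r ^ n * x) = x := by
      rw [map_inv₀, map_pow, ← IsScalarTower.algebraMap_apply,
        inv_mul_cancel_left₀ (pow_ne_zero n hr.ne_zero)]
    rw [← h2]
    exact isIntegral_algebraMap.mul hn.tower_top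
  have : FiniteDimensional K L := IntermediateField.finiteDimensional_adjoin hint
  have : IsNoetherian R (integralClosure R L) :=
    IsIntegralClosure.isNoetherian R K L _
  let f : ↥(T.restrictScalars R ⊓ integralClosure R Ω) →ₗ[R] integralClosure R L :=
    { toFun x := ⟨⟨x, hTL x x.2.1⟩, (isIntegral_algHom_iff (L.val.restrictScalars R)
        Subtype.val_injective).mp x.2.2⟩
      map_add' _ _ := rfl
      map_smul' _ _ := rfl }
  exact Module.Finite.of_injective f fun x y h ↦ Subtype.ext congr($h.1.1)

theorem isLocalizationAway_inf_integralClosure (r : R) [IsLocalization.Away r S]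
    (T : Subalgebra S Ω) [Algebra.IsIntegral S T]
    (C : Subalgebra R Ω) (hCT : C = T.restrictScalars R ⊓ integralClosure R Ω) [Algebra C T]
    (hC : ∀ c : C, (algebraMap C T c : Ω) = c) :
    IsLocalization.Away (algebraMap R C r) T := by
  have hr : IsUnit (algebraMap C T (algebraMap R C r)) := by
    have : algebraMap C T (algebraMap R C r) = algebraMap S T (algebraMap R S r) := by
      apply Subtype.ext
      rw [hC]
      exact IsScalarTower.algebraMap_apply R S Ω r
    rw [this]
    exact (IsLocalization.Away.algebraMap_isUnit r).map _
  refine (isLocalization_iff _ _).mpr ⟨?_, ?_, ?_⟩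
  · rintro ⟨_, n, rfl⟩
    simpa using hr.pow n
  · intro t
    obtain ⟨n, hn⟩ := exists_pow_mul_mem_integralClosure r
      ((Algebra.IsIntegral.isIntegral (R := S) t).map T.val)
    have hmem : algebraMap R Ω r ^ n * t ∈ T := by
      rw [IsScalarTower.algebraMap_apply R S Ω]
      exact mul_mem (pow_mem (T.algebraMap_mem _) n) t.2
    have hmemC : algebraMap R Ω r ^ n * t ∈ C := by rw [hCT]; exact ⟨hmem, hn⟩
    refine ⟨⟨⟨_, hmemC⟩, ⟨_, n, rfl⟩⟩, Subtype.ext ?_⟩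
    rw [hC]
    simp [hC, mul_comm]
  · intro x y h
    refine ⟨1, ?_⟩
    have : (x : Ω) = y := by rw [← hC, ← hC, h]
    simpa using Subtype.ext this

theorem isIntegrallyClosed_of_forall_mem {A : Type*} [CommRing A] [IsDomain A] [Algebra A Ω]
    [FaithfulSMul A Ω] (h : ∀ x : Ω, IsIntegral A x → ∀ a b : A, b ≠ 0 →
      x * algebraMap A Ω b = algebraMap A Ω a → ∃ y, algebraMap A Ω y = x) :
    IsIntegrallyClosed A := by
  let K := FractionRing A
  let : Algebra K Ω := FractionRing.liftAlgebra A Ω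
  have : IsScalarTower A K Ω := FractionRing.isScalarTower_liftAlgebra A Ω
  rw [isIntegrallyClosed_iff K]
  intro x hx
  obtain ⟨a, b, hb, rfl⟩ := IsFractionRing.div_surjective (A := A) x
  obtain ⟨y, hy⟩ := h _ (hx.map (IsScalarTower.toAlgHom A K Ω)) a b (nonZeroDivisors.ne_zero hb) (by
    have : algebraMap A Ω b ≠ 0 := by simpa using nonZeroDivisors.ne_zero hb
    simp [div_mul_cancel₀ _ this])
  refine ⟨y, (algebraMap K Ω).injective ?_⟩
  rw [← IsScalarTower.algebraMap_apply, hy]; rfl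

theorem isIntegrallyClosed_inf_integralClosure [IsDomain S] [IsIntegrallyClosed S]
    [FaithfulSMul S Ω] (T : Subalgebra S Ω) [Algebra.Etale S T] [Algebra.IsIntegral S T] :
    IsIntegrallyClosed ↥(T.restrictScalars R ⊓ integralClosure R Ω) := by
  refine isIntegrallyClosed_of_forall_mem (Ω := Ω) fun x hx a b hb h ↦ ?_
  have hxR : IsIntegral R x := by
    have : Algebra.IsIntegral R ↥(T.restrictScalars R ⊓ integralClosure R Ω) :=
      ⟨fun c ↦ (isIntegral_algHom_iff (Subalgebra.val _) Subtype.val_injective).mp c.2.2⟩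
    exact isIntegral_trans _ hx
  have hxT : x ∈ T := mem_of_isIntegral_of_etale T hxR.tower_top b.2.1
    (fun h ↦ hb (Subtype.ext h)) (h ▸ a.2.1)
  exact ⟨⟨x, hxT, hxR⟩, rfl⟩

end Away

theorem awayMap_algebraMap {R A : Type*} [CommRing R] [CommRing A] (f : R →+* A) (r x : R) :
    Localization.awayMap f r (algebraMap R _ x) = algebraMap A _ (f x) :=
  IsLocalization.map_eq (M := .powers r) (T := .powers (f r))
    (by rw [Submonoid.powers_le]; exact Submonoid.mem_powers _) x

section TildeSubring

variable {p : ℕ} {R Ω : Type u} [CommRing R] [Field Ω] [Algebra R Ω]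
  [Algebra (Localization.Away (p : R)) Ω] [IsScalarTower R (Localization.Away (p : R)) Ω]

theorem isFiniteNormalPEtaleSubalgebra_of_etale [IsDomain R] [IsIntegrallyClosed R]
    [IsNoetherianRing R] [CharZero R] [FaithfulSMul R Ω] [IsDomain (Localization.Away (p : R))]
    [IsIntegrallyClosed (Localization.Away (p : R))] [FaithfulSMul (Localization.Away (p : R)) Ω]
    (T : Subalgebra (Localization.Away (p : R)) Ω) [Module.Finite (Localization.Away (p : R)) T]
    [Algebra.Etale (Localization.Away (p : R)) T] :
    IsFiniteNormalPEtaleSubalgebra p R Ω (T.restrictScalars R ⊓ integralClosure R Ω) := by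
  have h1 := finite_inf_integralClosure (p : R) T
  have h2 := isIntegrallyClosed_inf_integralClosure (R := R) T
  refine ⟨h1, inferInstance, h2, ?_⟩
  set C := T.restrictScalars R ⊓ integralClosure R Ω with hCT
  let : Algebra (Localization.Away (p : R)) (Localization.Away (algebraMap R C (p : R))) :=
    (Localization.awayMap (algebraMap R C) (p : R)).toAlgebra
  let ι : C →+* T := (Subalgebra.inclusion (inf_le_left : C ≤ T.restrictScalars R)).toRingHom
  let : Algebra C T := ι.toAlgebra
  have h3 := isLocalizationAway_inf_integralClosure (p : R) T C hCT fun _ ↦ rfl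
  let e := IsLocalization.algEquiv (.powers (algebraMap R C (p : R)))
    (Localization.Away (algebraMap R C (p : R))) T
  have he : (e : _ →+* T).comp (algebraMap (Localization.Away (p : R))
      (Localization.Away (algebraMap R C (p : R)))) = algebraMap (Localization.Away (p : R)) T := by
    refine IsLocalization.ringHom_ext (.powers (p : R)) (RingHom.ext fun r ↦ ?_)
    have : algebraMap (Localization.Away (p : R)) (Localization.Away (algebraMap R C (p : R)))
        (algebraMap R _ r) = algebraMap C _ (algebraMap R C r) :=
      awayMap_algebraMap (algebraMap R C) (p : R) r
    simp only [RingHom.comp_apply, this, RingHom.coe_coe, AlgEquiv.commutes]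
    exact Subtype.ext (IsScalarTower.algebraMap_apply R (Localization.Away (p : R)) Ω r)
  let e' : T ≃ₐ[Localization.Away (p : R)] Localization.Away (algebraMap R C (p : R)) :=
    (AlgEquiv.ofRingEquiv (f := e.toRingEquiv) fun x ↦ congr($he x)).symm
  exact ⟨.equiv e'.toLinearEquiv, .of_equiv e'⟩

theorem mem_finiteEtaleUnion_of_isFiniteNormalPEtaleSubalgebra
    [IsDomain (Localization.Away (p : R))] [IsIntegrallyClosed (Localization.Away (p : R))]
    [FaithfulSMul (Localization.Away (p : R)) Ω] {A : Subalgebra R Ω}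
    (hA : IsFiniteNormalPEtaleSubalgebra p R Ω A) {x : Ω} (hx : x ∈ A) :
    x ∈ finiteEtaleUnion (Localization.Away (p : R)) Ω := by
  obtain ⟨_, _, _, h⟩ := hA
  let : Algebra (Localization.Away (p : R)) (Localization.Away (algebraMap R A (p : R))) :=
    (Localization.awayMap (algebraMap R A) (p : R)).toAlgebra
  obtain ⟨_, _⟩ := h
  have hp : IsUnit (algebraMap A Ω (algebraMap R A (p : R))) := by
    rw [← IsScalarTower.algebraMap_apply,
      IsScalarTower.algebraMap_apply R (Localization.Away (p : R)) Ω]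
    exact (IsLocalization.Away.algebraMap_isUnit (p : R)).map _
  let f : Localization.Away (algebraMap R A (p : R)) →+* Ω := IsLocalization.Away.lift _ hp
  have hf (a : A) : f (algebraMap A _ a) = a := IsLocalization.Away.lift_eq _ hp a
  have hfS : f.comp (algebraMap (Localization.Away (p : R)) _) =
      algebraMap (Localization.Away (p : R)) Ω := by
    refine IsLocalization.ringHom_ext (.powers (p : R)) (RingHom.ext fun r ↦ ?_)
    have : algebraMap (Localization.Away (p : R)) (Localization.Away (algebraMap R A (p : R)))
        (algebraMap R _ r) = algebraMap A _ (algebraMap R A r) :=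
      awayMap_algebraMap (algebraMap R A) (p : R) r
    simp only [RingHom.comp_apply, this, hf]
    exact IsScalarTower.algebraMap_apply R (Localization.Away (p : R)) Ω r
  let φ : Localization.Away (algebraMap R A (p : R)) →ₐ[Localization.Away (p : R)] Ω :=
    { f with commutes' := fun s ↦ congr($hfS s) }
  have := apply_mem_finiteEtaleUnion φ (algebraMap A _ ⟨x, hx⟩)
  rwa [show φ (algebraMap A _ ⟨x, hx⟩) = x from hf ⟨x, hx⟩] at this

end TildeSubring

/-- In a finite algebra over a local ring, every element becomes a unit after adding an
`n`-th power. -/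
theorem exists_isUnit_add_pow (R : Type*) {A : Type*} [CommRing R] [IsLocalRing R] [CommRing A]
    [Algebra R A] [Module.Finite R A] {n : ℕ} (hn : n ≠ 0) (a : A) :
    ∃ c : A, IsUnit (a + c ^ n) := by
  let m := IsLocalRing.maximalIdeal R
  let I := m.map (algebraMap R A)
  have hI : I ≤ Ideal.jacobson ⊥ := by
    refine le_sInf fun P ⟨_, hP⟩ ↦ ?_
    have := Ideal.isMaximal_comap_of_isIntegral_of_isMaximal (R := R) P
    exact Ideal.map_le_iff_le_comap.mpr (IsLocalRing.eq_maximalIdeal this).ge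
  have := isLocalHom_of_le_jacobson_bot I hI
  let : Field (R ⧸ m) := Ideal.Quotient.field m
  have : Module.Finite (R ⧸ m) (A ⧸ I) := .of_restrictScalars_finite R _ _
  have : IsArtinianRing (A ⧸ I) := .of_finite (R ⧸ m) _
  let b := Ideal.Quotient.mk I a
  obtain ⟨k, y, hy⟩ := IsArtinian.exists_pow_succ_smul_dvd b (1 : A ⧸ I)
  have h1 : b ^ (k + 1) * (b * y) = b ^ (k + 1) := by
    simp only [smul_eq_mul, Nat.succ_eq_add_one, mul_one] at hy
    calc b ^ (k + 1) * (b * y) = b * (b ^ (k + 1) * y) := by ring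
      _ = b ^ (k + 1) := by rw [hy, pow_succ']
  have h2 (j : ℕ) : b ^ (k + 1) * (b * y) ^ j = b ^ (k + 1) := by
    induction j with
    | zero => simp
    | succ j ih => rw [pow_succ (b * y), ← mul_assoc, ih, h1]
  let e := (b * y) ^ (k + 1)
  have he : IsIdempotentElem e := by
    have : e * e = b ^ (k + 1) * e * y ^ (k + 1) := by simp only [e]; ring
    rw [IsIdempotentElem, this, h2, ← mul_pow]
  obtain ⟨c, hc⟩ := Ideal.Quotient.mk_surjective (1 - e)
  refine ⟨c, isUnit_of_map_unit (Ideal.Quotient.mk I) _ ?_⟩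
  rw [map_add, map_pow, hc, he.one_sub.pow_eq hn]
  by_contra hu
  obtain ⟨P, hP, hmem⟩ := exists_max_ideal_of_mem_nonunits hu
  have hbe : b ^ (k + 1) * (1 - e) = 0 := by rw [mul_sub, h2, mul_one, sub_self]
  have hb : b ∈ P := by
    obtain h | h := hP.isPrime.mem_or_mem (hbe ▸ P.zero_mem : b ^ (k + 1) * (1 - e) ∈ P)
    · exact hP.isPrime.mem_of_pow_mem _ h
    · exact (P.add_mem_iff_left h).mp hmem
  have h1e : 1 - e ∈ P := (P.add_mem_iff_right hb).mp hmem
  have heP : e ∈ P := P.pow_mem_of_mem (P.mul_mem_right y hb) _ k.succ_pos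
  exact hP.ne_top ((P.eq_top_iff_one).mpr ((P.sub_mem_iff_left heP).mp h1e))

/-- An element of `Ω` lies in one of the subalgebras attached to `p` and `R` if and only if it is
integral over `R` and lies in a finite étale `R[1/p]`-subalgebra. -/
theorem exists_isFiniteNormalPEtaleSubalgebra_iff {p : ℕ} {R Ω : Type u} [CommRing R] [IsDomain R]
    [IsIntegrallyClosed R] [IsNoetherianRing R] [CharZero R] [Field Ω] [Algebra R Ω]
    [FaithfulSMul R Ω] [Algebra (Localization.Away (p : R)) Ω]
    [IsScalarTower R (Localization.Away (p : R)) Ω] [IsDomain (Localization.Away (p : R))]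
    [IsIntegrallyClosed (Localization.Away (p : R))]
    [FaithfulSMul (Localization.Away (p : R)) Ω] {x : Ω} :
    (∃ A : Subalgebra R Ω, IsFiniteNormalPEtaleSubalgebra p R Ω A ∧ x ∈ A) ↔
      x ∈ finiteEtaleUnion (Localization.Away (p : R)) Ω ∧ IsIntegral R x := by
  constructor
  · rintro ⟨A, hA, hx⟩
    have := hA.1
    exact ⟨mem_finiteEtaleUnion_of_isFiniteNormalPEtaleSubalgebra hA hx,
      (Algebra.IsIntegral.isIntegral (R := R) (⟨x, hx⟩ : A)).map A.val⟩
  · rintro ⟨hx, hx'⟩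
    obtain ⟨T, _, _, hxT⟩ := mem_finiteEtaleUnion.mp hx
    exact ⟨_, isFiniteNormalPEtaleSubalgebra_of_etale T, hxT, hx'⟩

/-- Let `R` be a complete Noetherian local normal domain, flat over
`ℤ_p`, with `p` in its maximal ideal.  Let `Ω` be an algebraic closure of the
fraction field of `R` and let `R̃ ⊆ Ω` be the union of all finite normal
`R`-subalgebras `R′` of `Ω` with `R′[1/p]` finite étale over `R[1/p]`.  Then:
(i) there exists `π ∈ R̃` with `π^p = p`; and (ii) for any such `π`, the
Frobenius map `R̃/πR̃ → R̃/pR̃`, `x ↦ x^p`, is a well-defined bijection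
(stated elementwise: `x ≡ y mod πR̃ ↔ x^p ≡ y^p mod pR̃`, and every element of
`R̃/pR̃` is a `p`-th power). -/
theorem frobenius_iso_of_tilde
    (p : ℕ) [Fact p.Prime]
    (R : Type u) [CommRing R] [IsNoetherianRing R] [IsLocalRing R]
    [IsAdicComplete (IsLocalRing.maximalIdeal R) R]
    [IsDomain R] [IsIntegrallyClosed R]
    [Algebra ℤ_[p] R] [Module.Flat ℤ_[p] R]
    (hp : (p : R) ∈ IsLocalRing.maximalIdeal R)
    (Ω : Type u) [Field Ω] [Algebra R Ω]
    (hinj : Function.Injective (algebraMap R Ω))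
    [IsAlgClosed Ω] [Algebra.IsAlgebraic R Ω]
    (Rt : Set Ω)
    (hRt : Rt = ⋃ A ∈ {A : Subalgebra R Ω | IsFiniteNormalPEtaleSubalgebra p R Ω A},
      (A : Set Ω)) :
    (∃ π ∈ Rt, π ^ p = algebraMap R Ω (p : R)) ∧
    (∀ π ∈ Rt, π ^ p = algebraMap R Ω (p : R) →
      ((∀ x ∈ Rt, ∀ y ∈ Rt,
          ((∃ z ∈ Rt, x - y = π * z) ↔
            (∃ w ∈ Rt, x ^ p - y ^ p = algebraMap R Ω (p : R) * w))) ∧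
        ∀ a ∈ Rt, ∃ b ∈ Rt, ∃ c ∈ Rt,
          a - b ^ p = algebraMap R Ω (p : R) * c)) := by
  have hpp : p.Prime := Fact.out
  have : CharZero R := charZero_of_injective_algebraMap (FaithfulSMul.algebraMap_injective ℤ_[p] R)
  have : FaithfulSMul R Ω := (faithfulSMul_iff_algebraMap_injective R Ω).mpr hinj
  have hpR : (p : R) ≠ 0 := Nat.cast_ne_zero.mpr hpp.ne_zero
  have hpΩ : algebraMap R Ω p ≠ 0 := (map_ne_zero_iff _ hinj).mpr hpR
  let S := Localization.Away (p : R)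
  have hle : Submonoid.powers (p : R) ≤ nonZeroDivisors R :=
    powers_le_nonZeroDivisors_of_noZeroDivisors hpR
  have : IsDomain S := IsLocalization.isDomain_localization hle
  have : IsIntegrallyClosed S := isIntegrallyClosed_of_isLocalization S (.powers (p : R)) hle
  let : Algebra S Ω := (IsLocalization.Away.lift (p : R) hpΩ.isUnit).toAlgebra
  have : IsScalarTower R S Ω :=
    .of_algebraMap_eq fun x ↦ (IsLocalization.Away.lift_eq (p : R) hpΩ.isUnit x).symm
  have : FaithfulSMul S Ω := by
    rw [faithfulSMul_iff_algebraMap_injective, injective_iff_map_eq_zero]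
    intro s hs
    obtain ⟨n, a, h⟩ := IsLocalization.Away.surj (p : R) s
    have ha : algebraMap R Ω a = 0 := by
      rw [IsScalarTower.algebraMap_apply R S Ω, ← h, map_mul, hs, zero_mul]
    rw [(map_eq_zero_iff _ hinj).mp ha, map_zero] at h
    exact (((IsLocalization.Away.algebraMap_isUnit (p : R)).pow n).mul_left_eq_zero).mp h
  have hpS : IsUnit (p : S) := by
    simpa using IsLocalization.Away.algebraMap_isUnit (S := S) (p : R)
  let G := finiteEtaleUnion S Ω
  let B : Subalgebra R Ω := G.restrictScalars R ⊓ integralClosure R Ω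
  have mem_B {x : Ω} : x ∈ B ↔ x ∈ G ∧ IsIntegral R x := .rfl
  obtain rfl : Rt = B := by
    ext x
    rw [SetLike.mem_coe, mem_B, ← exists_isFiniteNormalPEtaleSubalgebra_iff]
    simp [hRt]
  have hpG : (p : Ω)⁻¹ ∈ G := by
    obtain ⟨v, hv⟩ := hpS.exists_right_inv
    rw [← eq_inv_of_mul_eq_one_right (a := (p : Ω)) (b := algebraMap S Ω v)
      (by rw [← map_natCast (algebraMap S Ω), ← map_mul, hv, map_one])]
    exact G.algebraMap_mem v
  have hfrob (x y : Ω) (hx : x ∈ B) (hy : y ∈ B) :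
      ∃ r ∈ B, (x + y) ^ p = x ^ p + y ^ p + p * r := by
    obtain ⟨r, hr⟩ := exists_add_pow_prime_eq hpp (⟨x, hx⟩ : B) ⟨y, hy⟩
    refine ⟨x * y * r, mul_mem (mul_mem hx hy) r.2, ?_⟩
    simpa [mul_assoc] using congr(($hr : Ω))
  simp only [map_natCast, SetLike.mem_coe] at hpΩ ⊢
  refine ⟨?_, fun π hπ hπp ↦ ⟨fun x hx y hy ↦ ⟨?_, ?_⟩, fun a ha ↦ ?_⟩⟩
  · obtain ⟨π, hπ⟩ := IsAlgClosed.exists_pow_nat_eq (p : Ω) hpp.pos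
    refine ⟨π, ⟨mem_finiteEtaleUnion_of_pow_eq hpp.ne_zero hpS (natCast_mem G p) hpG
      (mul_inv_cancel₀ hpΩ) hπ, .of_pow hpp.pos ?_⟩, hπ⟩
    rw [hπ, ← map_natCast (algebraMap R Ω)]
    exact isIntegral_algebraMap
  · rintro ⟨z, hz, h⟩
    obtain ⟨r, hr, h'⟩ := hfrob (π * z) y (mul_mem hπ hz) hy
    refine ⟨z ^ p + r, add_mem (pow_mem hz p) hr, ?_⟩
    rw [eq_add_of_sub_eq h, h', mul_pow, hπp]
    ring
  · rintro ⟨w, hw, h⟩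
    obtain ⟨r, hr, h'⟩ := hfrob (x - y) y (sub_mem hx hy) hy
    have hπ0 : π ≠ 0 := by
      rintro rfl
      exact hpΩ (by rw [← hπp, zero_pow hpp.ne_zero])
    have hz : ((x - y) / π) ^ p = w - r := by
      rw [div_pow, hπp, div_eq_iff hpΩ]
      rw [sub_add_cancel] at h'
      linear_combination h - h'
    refine ⟨(x - y) / π, mem_B.mpr ⟨?_, .of_pow hpp.pos (hz ▸ (sub_mem hw hr).2)⟩,
      (mul_div_cancel₀ _ hπ0).symm⟩
    have : (x - y) / π = (x - y) * π ^ (p - 1) * (p : Ω)⁻¹ := by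
      rw [← hπp, div_eq_iff hπ0]
      field_simp
      rw [mul_assoc, pow_sub_one_mul hpp.ne_zero]
    rw [this]
    exact mul_mem (mul_mem (sub_mem hx hy).1 (pow_mem hπ.1 _)) hpG
  · obtain ⟨A, hA, haA⟩ := exists_isFiniteNormalPEtaleSubalgebra_iff.mpr (mem_B.mp ha)
    have := hA.1
    have hAB : A ≤ B := fun x hx ↦
      mem_B.mpr (exists_isFiniteNormalPEtaleSubalgebra_iff.mp ⟨A, hA, hx⟩)
    obtain ⟨c, hc⟩ := exists_isUnit_add_pow R hpp.ne_zero (⟨a, haA⟩ : A)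
    obtain ⟨v, hv⟩ := hc.exists_right_inv
    have hv' : (a + c ^ p) * v = (1 : Ω) := congr(($hv : Ω))
    obtain ⟨d, hd⟩ := IsAlgClosed.exists_pow_nat_eq (a + c ^ p : Ω) hpp.pos
    have hcB : (c : Ω) ∈ B := hAB c.2
    have hu : (a + c ^ p : Ω) ∈ B := add_mem ha (pow_mem hcB p)
    have hdB : d ∈ B := mem_B.mpr ⟨mem_finiteEtaleUnion_of_pow_eq hpp.ne_zero hpS hu.1
      (hAB v.2).1 hv' hd, .of_pow hpp.pos (hd ▸ hu.2)⟩
    obtain ⟨r, hr, h⟩ := hfrob (d - c) c (sub_mem hdB hcB) hcB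
    refine ⟨d - c, sub_mem hdB hcB, r, hr, ?_⟩
    rw [sub_add_cancel, hd] at h
    linear_combination h
end

section
/- Let p be a prime and let A be an integral domain which is a henselian local ring with p belonging to its maximal ideal. Then the set {x ∈ A/pA : x^p = x} of Frobenius-fixed elements of A/pA is exactly the image of the canonical ring homomorphism ℤ → A/pA; in particular it is a subring of A/pA isomorphic to the prime field 𝔽_p. -/
open Polynomial in
/-- In a local ring of prime characteristic `p`, an element fixed by Frobenius comes from `𝔽_p`. -/
theorem IsLocalRing.exists_zmod_castHom_eq_of_pow_eq_self
    (p : ℕ) [Fact p.Prime] (B : Type*) [CommRing B] [IsLocalRing B] [CharP B p]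
    {x : B} (hx : x ^ p = x) : ∃ n : ZMod p, ZMod.castHom dvd_rfl B n = x := by
  classical
  set φ : ZMod p →+* B := ZMod.castHom dvd_rfl B
  have hprod : ∏ n : ZMod p, (x - φ n) = 0 := by
    have hp1 : 1 < p := (Fact.out : p.Prime).one_lt
    have hroots : (X ^ p - X : (ZMod p)[X]).roots = Finset.univ.val := by
      simpa only [ZMod.card] using FiniteField.roots_X_pow_card_sub_X (ZMod p)
    have hfactor : ∏ n : ZMod p, (X - C n) = (X ^ p - X : (ZMod p)[X]) := by
      have h := prod_multiset_X_sub_C_of_monic_of_roots_card_eq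
        (monic_X_pow_sub (p := (X : (ZMod p)[X])) (n := p) (by rw [degree_X]; exact_mod_cast hp1))
        (by rw [hroots, FiniteField.X_pow_card_sub_X_natDegree_eq _ hp1, Finset.card_val,
          Finset.card_univ, ZMod.card])
      rwa [hroots] at h
    simpa [eval₂_finsetProd, hx] using congrArg (eval₂ φ x) hfactor
  obtain ⟨n, hn⟩ : ∃ n, ¬ IsUnit (x - φ n) := by
    by_contra! h
    exact not_isUnit_zero (hprod ▸ IsUnit.prod_univ_iff.2 h)
  refine ⟨n, ?_⟩
  have hu : IsUnit (∏ k ∈ Finset.univ.erase n, (x - φ k)) := by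
    refine IsUnit.prod_iff.2 fun k hk => ?_
    have hd : IsUnit (φ (n - k)) :=
      (sub_ne_zero.2 (Finset.ne_of_mem_erase hk).symm).isUnit.map φ
    by_contra hk'
    refine IsLocalRing.nonunits_add (a := x - φ k) (b := -(x - φ n)) hk'
      (mt (IsUnit.neg_iff _).1 hn) ?_
    convert hd using 1
    rw [map_sub]
    ring
  rw [← Finset.mul_prod_erase _ _ (Finset.mem_univ n), hu.mul_left_eq_zero] at hprod
  exact (sub_eq_zero.1 hprod).symm

/-- Let `A` be an integral domain which is a henselian local ring
with `p` in its maximal ideal.  Then the Frobenius-fixed elements of `A/pA` are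
exactly the image of the canonical map `ℤ → A/pA`; in particular they form a
subring isomorphic to `𝔽_p = ZMod p`. -/
theorem frobenius_fixed_points_of_henselian_domain
    (p : ℕ) [Fact p.Prime]
    (A : Type*) [CommRing A] [IsDomain A] [HenselianLocalRing A]
    (hp : (p : A) ∈ IsLocalRing.maximalIdeal A) :
    {x : A ⧸ Ideal.span {(p : A)} | x ^ p = x} =
      Set.range (Int.cast : ℤ → A ⧸ Ideal.span {(p : A)}) ∧
    Nonempty (ZMod p ≃+* (Int.castRingHom (A ⧸ Ideal.span {(p : A)})).range) := by
  have hnt : Nontrivial (A ⧸ Ideal.span {(p : A)}) :=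
    Ideal.Quotient.nontrivial_iff.2 fun h => hp (Ideal.span_singleton_eq_top.1 h)
  have : IsLocalRing (A ⧸ Ideal.span {(p : A)}) :=
    .of_surjective' (Ideal.Quotient.mk _) Ideal.Quotient.mk_surjective
  have hp0 : (p : A ⧸ Ideal.span {(p : A)}) = 0 := by
    rw [← map_natCast (Ideal.Quotient.mk _), Ideal.Quotient.eq_zero_iff_mem]
    exact Ideal.mem_span_singleton_self _
  have : CharP (A ⧸ Ideal.span {(p : A)}) p :=
    (CharP.charP_iff_prime_eq_zero Fact.out).2 hp0
  set φ := ZMod.castHom dvd_rfl (A ⧸ Ideal.span {(p : A)})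
  constructor
  · ext x
    constructor
    · intro hx
      obtain ⟨n, rfl⟩ := IsLocalRing.exists_zmod_castHom_eq_of_pow_eq_self p _ hx
      obtain ⟨m, rfl⟩ := ZMod.intCast_surjective n
      exact ⟨m, (map_intCast φ m).symm⟩
    · rintro ⟨m, rfl⟩
      change (m : A ⧸ Ideal.span {(p : A)}) ^ p = m
      rw [← map_intCast φ m, ← map_pow, ZMod.pow_card]
  · have hr : (Int.castRingHom (A ⧸ Ideal.span {(p : A)})).range = φ.range := by
      rw [← RingHom.eq_intCast' (φ.comp (Int.castRingHom (ZMod p))), ← RingHom.map_range,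
        RingHom.range_eq_top.2 ZMod.intCast_surjective, RingHom.range_eq_map]
    rw [hr]
    exact ⟨RingEquiv.ofBijective φ.rangeRestrict
      ⟨φ.rangeRestrict.injective, φ.rangeRestrict_surjective⟩⟩
end

section
/- Let p be a prime and B a perfect commutative ring of characteristic p (i.e., the Frobenius x ↦ x^p of B is bijective). Then in the ring W(B) of p-typical Witt vectors of B: (i) p is not a zero divisor; (ii) the ideal p·W(B) equals the kernel I_B of the first-component projection W(B) → B, so that W(B)/pW(B) ≅ B; (iii) W(B) is p-adically complete and separated. (iv) If in addition B is a henselian local ring, then W(B) is a henselian local ring. -/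
/-- The henselian property of a local ring lifts along a surjection whose source is henselian at
the kernel. -/
theorem HenselianLocalRing.of_surjective_of_henselianRing_ker {R S : Type*} [CommRing R]
    [CommRing S] (φ : R →+* S) (hφ : Function.Surjective φ) [HenselianRing R (RingHom.ker φ)]
    [HenselianLocalRing S] : HenselianLocalRing R := by
  have : IsLocalHom (Ideal.Quotient.mk (RingHom.ker φ)) :=
    isLocalHom_of_le_jacobson_bot _ HenselianRing.jac
  have isUnit_mk (x : R) (hx : IsUnit (φ x)) : IsUnit (Ideal.Quotient.mk (RingHom.ker φ) x) := by
    rw [← isUnit_map_iff (RingHom.quotientKerEquivOfSurjective hφ)]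
    simpa using hx
  have : IsLocalHom φ := ⟨fun x hx => IsUnit.of_map (Ideal.Quotient.mk _) x (isUnit_mk x hx)⟩
  have : IsLocalRing R := RingHom.domain_isLocalRing φ
  refine ⟨fun f hf a₀ h₀ h₁ => ?_⟩
  obtain ⟨b, hb, hb₀⟩ := HenselianLocalRing.is_henselian (f.map φ) (hf.map φ) (φ a₀)
    (by simpa [Polynomial.eval_map_apply] using h₀)
    (by simpa [Polynomial.derivative_map, Polynomial.eval_map_apply] using h₁.map φ)
  obtain ⟨a₁, rfl⟩ := hφ b
  have ha₁ : a₁ - a₀ ∈ IsLocalRing.maximalIdeal R := by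
    rw [← map_sub, IsLocalRing.mem_maximalIdeal] at hb₀
    rw [IsLocalRing.mem_maximalIdeal]
    exact fun h => hb₀ (h.map φ)
  have hd : IsUnit (f.derivative.eval a₁) := by
    have hsub : f.derivative.eval a₁ - f.derivative.eval a₀ ∈ IsLocalRing.maximalIdeal R :=
      Ideal.mem_of_dvd _ (Polynomial.sub_dvd_eval_sub a₁ a₀ f.derivative) ha₁
    by_contra h
    have := (IsLocalRing.maximalIdeal R).sub_mem ((IsLocalRing.mem_maximalIdeal _).2 h) hsub
    rw [sub_sub_cancel] at this
    exact (IsLocalRing.mem_maximalIdeal _).1 this h₁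
  obtain ⟨a, ha, haa₁⟩ := HenselianRing.is_henselian (I := RingHom.ker φ) f hf a₁
    (by simpa [RingHom.mem_ker, Polynomial.IsRoot, Polynomial.eval_map_apply] using hb)
    (hd.map _)
  refine ⟨a, ha, ?_⟩
  rw [← sub_add_sub_cancel a a₁ a₀]
  exact Ideal.add_mem _ (IsLocalRing.le_maximalIdeal (RingHom.ker_ne_top φ) haa₁) ha₁

/-- Let `B` be a perfect commutative ring of characteristic `p`.
Then in `W(B)`: (i) `p` is not a zero divisor; (ii) `p·W(B)` equals the kernel
of the first-component projection `W(B) → B`, so `W(B)/pW(B) ≅ B` via that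
projection; (iii) `W(B)` is `p`-adically complete and separated; (iv) if `B` is
a henselian local ring, then so is `W(B)`. -/
theorem wittVector_of_perfect_ring_properties
    (p : ℕ) [Fact p.Prime] (B : Type*) [CommRing B] [CharP B p]
    (hperf : Function.Bijective (fun x : B => x ^ p)) :
    ((p : WittVector p B) ∈ nonZeroDivisors (WittVector p B)) ∧
    (Ideal.span {(p : WittVector p B)} =
      RingHom.ker (WittVector.constantCoeff : WittVector p B →+* B)) ∧
    (∃ e : (WittVector p B ⧸ Ideal.span {(p : WittVector p B)}) ≃+* B,
      ∀ x : WittVector p B,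
        e (Ideal.Quotient.mk (Ideal.span {(p : WittVector p B)}) x) =
          WittVector.constantCoeff x) ∧
    IsAdicComplete (Ideal.span {(p : WittVector p B)}) (WittVector p B) ∧
    (HenselianLocalRing B → HenselianLocalRing (WittVector p B)) := by
  have : PerfectRing B p := ⟨hperf⟩
  have hker := WittVector.ker_constantCoeff (p := p) (k := B)
  refine ⟨mem_nonZeroDivisors_iff_right.2 WittVector.eq_zero_of_p_mul_eq_zero, hker.symm,
    ⟨WittVector.quotientPEquiv, WittVector.quotientPEquiv_mk⟩, inferInstance, fun _ => ?_⟩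
  have : HenselianRing (WittVector p B)
      (RingHom.ker (WittVector.constantCoeff : WittVector p B →+* B)) := by
    rw [hker]
    infer_instance
  exact .of_surjective_of_henselianRing_ker WittVector.constantCoeff
    (WittVector.constantCoeff_surjective p)
end

section
/- Let p be a prime and B a perfect commutative ring of characteristic p such that the set {b ∈ B : b^p = b} of Frobenius-fixed elements of B equals the image of the prime field 𝔽_p in B. Then the subring of Frobenius-fixed elements of the Witt ring W(B), namely {f ∈ W(B) : φ(f) = f}, equals the image of the canonical ring homomorphism ℤ_p ≅ W(𝔽_p) → W(B). -/
/-- Let `B` be a perfect commutative ring of characteristic `p`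
whose Frobenius-fixed elements are exactly the image of `𝔽_p`.  Then the
Frobenius-fixed elements of `W(B)` are exactly the image of the canonical map
`ℤ_p ≅ W(𝔽_p) → W(B)`. -/
theorem wittVector_frobenius_fixed_points
    (p : ℕ) [Fact p.Prime] (B : Type*) [CommRing B] [CharP B p]
    (hperf : Function.Bijective (fun x : B => x ^ p))
    (hfix : {b : B | b ^ p = b} = Set.range (ZMod.castHom (dvd_refl p) B)) :
    {f : WittVector p B | WittVector.frobenius f = f} =
      Set.range ((WittVector.map (ZMod.castHom (dvd_refl p) B)).comp
        ((WittVector.equiv p).symm.toRingHom) : ℤ_[p] → WittVector p B) := by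
  have hrange : ∀ b : B, b ^ p = b ↔ ∃ a, ZMod.castHom (dvd_refl p) B a = b := fun b => by
    simpa using Set.ext_iff.mp hfix b
  ext f
  constructor
  · intro hf
    have hcoeff : ∀ n, ∃ a, ZMod.castHom (dvd_refl p) B a = f.coeff n := fun n => by
      rw [← hrange, ← WittVector.coeff_frobenius_charP, show WittVector.frobenius f = f from hf]
    choose a ha using hcoeff
    refine ⟨WittVector.equiv p (WittVector.mk p a), ?_⟩
    ext n
    simp [WittVector.map_coeff, ← ha]
  · rintro ⟨x, rfl⟩
    ext n
    rw [WittVector.coeff_frobenius_charP, hrange]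
    exact ⟨((WittVector.equiv p).symm x).coeff n, (WittVector.map_coeff _ _ n).symm⟩
end

section
/- Let p be a prime, let R be a complete Noetherian local normal domain, flat over ℤ_p, with p in its maximal ideal, and let R̃ be the union, inside a fixed algebraic closure Ω of the fraction field of R, of all finite normal R-subalgebras R′ of Ω such that R′[1/p] is finite étale over R[1/p]. Then the set {x ∈ R̃/pR̃ : x^p = x} of Frobenius-fixed elements of R̃/pR̃ equals the image of the canonical map ℤ → R̃/pR̃, i.e., it is the prime field 𝔽_p. -/
universe u

open TensorProduct in
/-- A finite module over an adically complete Noetherian ring is adically complete. -/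
theorem IsAdicComplete.of_finite_of_isNoetherianRing {R : Type u} [CommRing R] [IsNoetherianRing R]
    (I : Ideal R) [IsAdicComplete I R] (M : Type u) [AddCommGroup M] [Module R M]
    [Module.Finite R M] : IsAdicComplete I M := by
  have hR : Function.Bijective (Algebra.linearMap R (AdicCompletion I R)) :=
    AdicCompletion.of_bijective I R
  let e := LinearEquiv.ofBijective _ hR
  let e' : M ≃ₗ[R] AdicCompletion I R ⊗[R] M :=
    (TensorProduct.lid R M).symm ≪≫ₗ TensorProduct.congr e (LinearEquiv.refl R M)
  rw [← AdicCompletion.of_bijective_iff]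
  have h : (AdicCompletion.of I M : M → AdicCompletion I M) =
      AdicCompletion.ofTensorProduct I M ∘ e' := by
    ext1 x
    have : e' x = 1 ⊗ₜ x := by simp [e', e]
    simp [this]
  rw [h]
  exact (AdicCompletion.ofTensorProduct_bijective_of_finite_of_isNoetherian I M).comp e'.bijective

open Polynomial in
/-- Every residue class modulo `p` lifts to a `p`-adic integer fixed by `t ↦ t ^ p`. -/
theorem PadicInt.exists_pow_eq_self_toZMod_eq {p : ℕ} [Fact p.Prime] (a : ZMod p) :
    ∃ t : ℤ_[p], t ^ p = t ∧ PadicInt.toZMod t = a := by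
  have hp := (Fact.out : p.Prime)
  obtain ⟨a₀, rfl⟩ := ZMod.ringHom_surjective (PadicInt.toZMod (p := p)) a
  have hker (u : ℤ_[p]) : u ∈ IsLocalRing.maximalIdeal ℤ_[p] ↔ PadicInt.toZMod u = 0 := by
    rw [← PadicInt.ker_toZMod, RingHom.mem_ker]
  obtain ⟨t, ht, hta⟩ := HenselianRing.is_henselian (I := IsLocalRing.maximalIdeal ℤ_[p])
    (X ^ p - X : ℤ_[p][X]) (monic_X_pow_sub (degree_X_le.trans_lt (mod_cast hp.one_lt))) a₀
    (by rw [hker]; simp)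
    (IsUnit.map _ (by
      rw [← IsLocalRing.notMem_maximalIdeal, hker]
      simp [derivative_X_pow]))
  refine ⟨t, by simpa [IsRoot, sub_eq_zero] using ht, ?_⟩
  rwa [hker, map_sub, sub_eq_zero] at hta

open Polynomial in
/-- In a domain receiving a map from `ℤ_[p]`, the solutions of `y ^ p = y` come from `ℤ_[p]`. -/
theorem PadicInt.mem_range_of_pow_eq_self {p : ℕ} [Fact p.Prime] {B : Type*} [CommRing B]
    [IsDomain B] (φ : ℤ_[p] →+* B) {y : B} (hy : y ^ p = y) : y ∈ φ.range := by
  classical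
  have hp := (Fact.out : p.Prime)
  choose t ht hta using PadicInt.exists_pow_eq_self_toZMod_eq (p := p)
  have hinj : Function.Injective (fun a => φ (t a)) := by
    intro a b hab
    by_contra hne
    have hu : IsUnit (t a - t b) := by
      rw [← IsLocalRing.notMem_maximalIdeal, ← PadicInt.ker_toZMod, RingHom.mem_ker, map_sub,
        hta, hta]
      exact sub_ne_zero.mpr hne
    exact (hu.map φ).ne_zero (by rw [map_sub]; exact sub_eq_zero.mpr hab)
  have hne : (X ^ p - X : B[X]) ≠ 0 :=
    (monic_X_pow_sub (degree_X_le.trans_lt (mod_cast hp.one_lt))).ne_zero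
  have hroots (z : B) : z ∈ (X ^ p - X : B[X]).roots.toFinset ↔ z ^ p = z := by
    rw [Multiset.mem_toFinset, mem_roots hne, IsRoot, eval_sub, eval_pow, eval_X, sub_eq_zero]
  have heq : Finset.univ.image (fun a => φ (t a)) = (X ^ p - X : B[X]).roots.toFinset := by
    refine Finset.eq_of_subset_of_card_le (fun z hz => ?_) ?_
    · obtain ⟨a, -, rfl⟩ := Finset.mem_image.mp hz
      rw [hroots, ← map_pow, ht]
    · rw [Finset.card_image_of_injective _ hinj, Finset.card_univ, ZMod.card]
      refine (Multiset.toFinset_card_le _).trans ((card_roots' _).trans ?_)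
      compute_degree
      simp [hp.one_lt.le]
  have hmem := (hroots y).mpr hy
  rw [← heq, Finset.mem_image] at hmem
  obtain ⟨a, -, ha⟩ := hmem
  exact ⟨t a, ha⟩

open Polynomial in
/-- In a ring complete along an ideal containing `p`, a Frobenius-fixed class modulo `p` lifts to
a solution of `y ^ p = y`. -/
theorem exists_pow_eq_self_of_dvd_pow_sub_self {p : ℕ} [Fact p.Prime] {A : Type*} [CommRing A]
    (J : Ideal A) [IsAdicComplete J A] (hpJ : (p : A) ∈ J) {x : A} (hx : (p : A) ∣ x ^ p - x) :
    ∃ y : A, y ^ p = y ∧ (p : A) ∣ x - y := by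
  have hp := (Fact.out : p.Prime)
  obtain ⟨y, hy, hyx⟩ := HenselianRing.is_henselian (I := J)
    (X ^ p - X : A[X]) (monic_X_pow_sub (degree_X_le.trans_lt (mod_cast hp.one_lt))) x
    (by simpa using Ideal.mem_of_dvd _ hx hpJ)
    (by
      have : Ideal.Quotient.mk J (p : A) = 0 := Ideal.Quotient.eq_zero_iff_mem.mpr hpJ
      simp only [derivative_X_pow, derivative_X, eval_sub, eval_mul, eval_C,
        eval_pow, eval_X, eval_one, map_sub, map_mul, this, zero_mul, map_one, zero_sub]
      exact isUnit_one.neg)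
  have hyp : y ^ p = y := by simpa [IsRoot, sub_eq_zero] using hy
  refine ⟨y, hyp, ?_⟩
  obtain ⟨h, rfl⟩ : ∃ h, x = y + h := ⟨x - y, by ring⟩
  have hh : h ∈ J := by simpa using J.neg_mem hyx
  obtain ⟨r, hr⟩ := exists_add_pow_prime_eq hp y h
  have hunit : IsUnit (h ^ (p - 1) - 1) := by
    have h1 : h ^ (p - 1) ∈ J := J.pow_mem_of_mem hh _ (Nat.sub_pos_of_lt hp.one_lt)
    have := Ideal.mem_jacobson_bot.mp (IsAdicComplete.le_jacobson_bot J h1) (-1)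
    rw [← IsUnit.neg_iff]
    convert! this using 1
    ring
  rw [add_sub_cancel_left, ← hunit.dvd_mul_right]
  have hpow : h * h ^ (p - 1) = h ^ p := by rw [← pow_succ', Nat.sub_add_cancel hp.one_lt.le]
  have : h * (h ^ (p - 1) - 1) = (y + h) ^ p - (y + h) - p * (y * h * r) := by
    rw [mul_sub, hpow, hr, hyp]; ring
  rw [this]
  exact dvd_sub hx (dvd_mul_right _ _)

/-- In a domain finite over a Noetherian `ℤ_[p]`-algebra complete along an ideal containing `p`,
the Frobenius-fixed classes modulo `p` are those of integers. -/
theorem exists_int_dvd_sub_of_dvd_pow_sub_self {p : ℕ} [Fact p.Prime]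
    {R : Type u} [CommRing R] [IsNoetherianRing R] (I : Ideal R) [IsAdicComplete I R]
    [Algebra ℤ_[p] R] (hp : (p : R) ∈ I)
    {A : Type u} [CommRing A] [IsDomain A] [Algebra R A] [Module.Finite R A]
    {x : A} (hx : (p : A) ∣ x ^ p - x) : ∃ n : ℤ, (p : A) ∣ x - n := by
  have := IsAdicComplete.of_finite_of_isNoetherianRing I A
  have := (IsAdicComplete.map_algebraMap_iff (I := I) (S := A) (M := A)).mpr this
  obtain ⟨y, hy, hxy⟩ := exists_pow_eq_self_of_dvd_pow_sub_self (I.map (algebraMap R A))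
    (by simpa using Ideal.mem_map_of_mem (algebraMap R A) hp) hx
  let φ : ℤ_[p] →+* A := (algebraMap R A).comp (algebraMap ℤ_[p] R)
  obtain ⟨t, rfl⟩ := PadicInt.mem_range_of_pow_eq_self φ hy
  obtain ⟨n, hn⟩ : ∃ n : ℤ, PadicInt.toZMod t = n := ⟨_, (ZMod.intCast_zmod_cast _).symm⟩
  have hmem : t - n ∈ IsLocalRing.maximalIdeal ℤ_[p] := by
    rw [← PadicInt.ker_toZMod, RingHom.mem_ker, map_sub, hn, map_intCast, sub_self]
  rw [PadicInt.maximalIdeal_eq_span_p, Ideal.mem_span_singleton] at hmem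
  refine ⟨n, ?_⟩
  have := map_dvd φ hmem
  rw [map_sub, map_intCast, map_natCast] at this
  simpa using dvd_add hxy this

/-- In a normal domain `A` inside a field, a quotient `a / b` of elements of `A` that is integral
over `A` lies in `A`. -/
theorem IsIntegrallyClosed.exists_eq_of_isIntegral_of_mul_eq {A : Type*} [CommRing A] [IsDomain A]
    [IsIntegrallyClosed A] {Ω : Type*} [Field Ω] [Algebra A Ω]
    (hinj : Function.Injective (algebraMap A Ω)) {a b : A} (hb : b ≠ 0) {z : Ω}
    (hz : IsIntegral A z) (h : algebraMap A Ω a = algebraMap A Ω b * z) :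
    ∃ c : A, algebraMap A Ω c = z := by
  let K := FractionRing A
  let φ : K →ₐ[A] Ω := IsFractionRing.liftAlgHom (g := Algebra.ofId A Ω) hinj
  have hφ : φ (algebraMap A K a / algebraMap A K b) = z := by
    rw [map_div₀, φ.commutes, φ.commutes, h, mul_div_cancel_left₀]
    exact (map_ne_zero_iff _ hinj).mpr hb
  rw [← hφ, isIntegral_algHom_iff φ φ.toRingHom.injective, IsIntegrallyClosed.isIntegral_iff] at hz
  obtain ⟨c, hc⟩ := hz
  exact ⟨c, by rw [← hφ, ← hc, φ.commutes]⟩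

/-- The image of a normal domain `R` in `Ω` is a finite normal `R`-subalgebra that is étale
after inverting `p`. -/
theorem isFiniteNormalPEtaleSubalgebra_bot (p : ℕ) {R : Type u} [CommRing R] [IsDomain R]
    [IsIntegrallyClosed R] {Ω : Type u} [CommRing Ω] [IsDomain Ω] [Algebra R Ω]
    (hinj : Function.Injective (algebraMap R Ω)) :
    IsFiniteNormalPEtaleSubalgebra p R Ω ⊥ := by
  let e : R ≃ₐ[R] (⊥ : Subalgebra R Ω) := (Algebra.botEquivOfInjective hinj).symm
  have hbij : Function.Bijective (algebraMap R (⊥ : Subalgebra R Ω)) := by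
    convert! e.bijective using 1
  have hloc : Function.Bijective
      (Localization.awayMap (algebraMap R (⊥ : Subalgebra R Ω)) (p : R)) := by
    refine ⟨(IsLocalization.Away.map_injective_iff ..).mpr fun a h => ⟨0, ?_⟩,
      Localization.awayMap_surjective_iff.mpr fun a => ?_⟩
    · rw [hbij.1 (h.trans (map_zero _).symm), mul_zero]
    · obtain ⟨c, rfl⟩ := hbij.2 a
      exact ⟨c, 0, by simp⟩
  refine ⟨.equiv e.toLinearEquiv, inferInstance, .of_equiv e.toRingEquiv, ?_, ?_⟩
  · exact RingHom.Finite.of_surjective _ hloc.2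
  · exact RingHom.Etale.of_bijective hloc

/-- With `R` a complete Noetherian local normal domain flat over
`ℤ_p` with `p` in its maximal ideal, and `R̃ ⊆ Ω` the union of all finite normal
`R`-subalgebras `R′` of an algebraic closure `Ω` of `Frac(R)` with `R′[1/p]`
finite étale over `R[1/p]`, the Frobenius-fixed elements of `R̃/pR̃` are exactly
the image of `ℤ`, i.e. the prime field `𝔽_p`.  Stated elementwise: every integer
lies in `R̃`, and for `x ∈ R̃`, `x^p ≡ x mod pR̃` if and only if `x ≡ n mod pR̃`
for some integer `n`. -/
theorem frobenius_fixed_points_of_tilde_mod_p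
    (p : ℕ) [Fact p.Prime]
    (R : Type u) [CommRing R] [IsNoetherianRing R] [IsLocalRing R]
    [IsAdicComplete (IsLocalRing.maximalIdeal R) R]
    [IsDomain R] [IsIntegrallyClosed R]
    [Algebra ℤ_[p] R] [Module.Flat ℤ_[p] R]
    (hp : (p : R) ∈ IsLocalRing.maximalIdeal R)
    (Ω : Type u) [Field Ω] [Algebra R Ω]
    (hinj : Function.Injective (algebraMap R Ω))
    [IsAlgClosed Ω] [Algebra.IsAlgebraic R Ω]
    (Rt : Set Ω)
    (hRt : Rt = ⋃ A ∈ {A : Subalgebra R Ω | IsFiniteNormalPEtaleSubalgebra p R Ω A},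
      (A : Set Ω)) :
    (∀ n : ℤ, (n : Ω) ∈ Rt) ∧
    (∀ x ∈ Rt,
      ((∃ z ∈ Rt, x ^ p - x = algebraMap R Ω (p : R) * z) ↔
        (∃ n : ℤ, ∃ w ∈ Rt, x - (n : Ω) = algebraMap R Ω (p : R) * w))) := by
  have hmem (w : Ω) : w ∈ Rt ↔ ∃ A : Subalgebra R Ω,
      IsFiniteNormalPEtaleSubalgebra p R Ω A ∧ w ∈ A := by
    simp [hRt]
  simp only [hmem, map_natCast]
  refine ⟨fun n => ⟨⊥, isFiniteNormalPEtaleSubalgebra_bot p hinj, intCast_mem _ n⟩, ?_⟩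
  rintro x ⟨A, hA, hxA⟩
  constructor
  · rintro ⟨z, ⟨B, hB, hzB⟩, hz⟩
    obtain ⟨hAfin, hAdom, hAnorm, -⟩ := id hA
    have hBfin := hB.1
    have hpR : (p : R) ≠ 0 := by
      have hinj' := FaithfulSMul.algebraMap_injective ℤ_[p] R
      rw [← map_natCast (algebraMap ℤ_[p] R), Ne, map_eq_zero_iff _ hinj']
      exact PadicInt.prime_p.ne_zero
    have hpA : (p : A) ≠ 0 := fun h => hpR (hinj (by
      simpa using! congrArg (algebraMap A Ω) h))
    have hzint : IsIntegral A z :=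
      ((IsIntegral.of_finite R (⟨z, hzB⟩ : B)).map B.val).tower_top
    obtain ⟨c, rfl⟩ := IsIntegrallyClosed.exists_eq_of_isIntegral_of_mul_eq
      (a := (⟨x, hxA⟩ : A) ^ p - ⟨x, hxA⟩) (b := (p : A)) Subtype.val_injective hpA hzint
      (by simpa using! hz)
    obtain ⟨n, w, hw⟩ := exists_int_dvd_sub_of_dvd_pow_sub_self
      (IsLocalRing.maximalIdeal R) hp (x := (⟨x, hxA⟩ : A))
      ⟨c, Subtype.val_injective (by simpa using! hz)⟩
    exact ⟨n, w, ⟨A, hA, w.2⟩, by simpa using! congrArg (algebraMap A Ω) hw⟩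
  · rintro ⟨n, w, ⟨B, hB, hwB⟩, hw⟩
    lift w to B using hwB
    obtain ⟨k, hk⟩ : (p : ℤ) ∣ n ^ p - n := by
      rw [← ZMod.intCast_eq_intCast_iff_dvd_sub]
      simp
    obtain ⟨r, hr⟩ := exists_add_pow_prime_eq (Fact.out : p.Prime) (n : B) (p * w)
    have hk' : (n : B) ^ p - n = p * k := mod_cast congrArg (Int.cast : ℤ → B) hk
    have hx : x ^ p - x = (p : Ω) * ((k + n * w * r * p - w + p ^ (p - 1) * w ^ p : B) : Ω) := by
      have hpow : (p : B) * p ^ (p - 1) = p ^ p := by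
        rw [← pow_succ', Nat.sub_add_cancel (Fact.out : p.Prime).one_lt.le]
      rw [show x = ((n + p * w : B) : Ω) by push_cast; linear_combination hw]
      have : (n + p * w) ^ p - (n + p * w) = p * (k + n * w * r * p - w + p ^ (p - 1) * w ^ p) := by
        rw [hr]
        linear_combination hk' - w ^ p * hpow
      exact_mod_cast congrArg (Subtype.val : B → Ω) this
    exact ⟨_, ⟨B, hB, (k + n * w * r * p - w + p ^ (p - 1) * w ^ p : B).2⟩, hx⟩
end

section
/- Let A be a commutative ring which is the union of a directed (by inclusion) family (A_i)_{i∈I} of subrings such that each A_i is a henselian local ring and, whenever A_i ⊆ A_j, the inclusion A_i → A_j is a local homomorphism (maps the maximal ideal of A_i into that of A_j). Then A is a henselian local ring, whose maximal ideal is the union of the maximal ideals of the A_i. -/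
namespace Subring

open Polynomial IsLocalRing

variable {A ι : Type*} [CommRing A] {S : ι → Subring A}

/-- If a ring is a directed union of subrings with local transition maps, then the inclusion of
each of these subrings is local. -/
theorem isLocalHom_subtype_of_directed (hdir : Directed (· ≤ ·) S)
    (hunion : ∀ x : A, ∃ i, x ∈ S i)
    (hloc : ∀ i j (hij : S i ≤ S j), IsLocalHom (inclusion hij)) (i : ι) :
    IsLocalHom (S i).subtype where
  map_nonunit x hx := by
    obtain ⟨y, hxy⟩ := isUnit_iff_exists_inv.mp hx
    obtain ⟨j, hy⟩ := hunion y
    obtain ⟨k, hik, hjk⟩ := hdir i j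
    have := hloc i k hik
    refine isUnit_of_map_unit (inclusion hik) x (isUnit_iff_exists_inv.mpr ⟨⟨y, hjk hy⟩, ?_⟩)
    exact Subtype.ext hxy

/-- A directed union of local subrings is local. -/
theorem isLocalRing_of_union [Nonempty ι] [∀ i, IsLocalRing (S i)]
    (hunion : ∀ x : A, ∃ i, x ∈ S i) : IsLocalRing A := by
  have : Nontrivial A := (S (Classical.arbitrary ι)).subtype_injective.nontrivial
  refine .of_isUnit_or_isUnit_one_sub_self fun a => ?_
  obtain ⟨i, ha⟩ := hunion a
  exact (isUnit_or_isUnit_one_sub_self (⟨a, ha⟩ : S i)).imp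
    (fun h => h.map (S i).subtype) (fun h => h.map (S i).subtype)

/-- A finite subset of a directed union of subrings lies in one of them. -/
theorem exists_finset_subset_of_directed [Nonempty ι] (hdir : Directed (· ≤ ·) S)
    (hunion : ∀ x : A, ∃ i, x ∈ S i) (s : Finset A) : ∃ i, (s : Set A) ⊆ S i := by
  classical
  choose g hg using hunion
  obtain ⟨k, hk⟩ := hdir.finset_le (s.image g)
  exact ⟨k, fun x hx => hk (g x) (Finset.mem_image_of_mem g hx) (hg x)⟩

/-- A local ring which is a directed union of henselian local subrings with local inclusions
is henselian. -/
theorem henselianLocalRing_of_directed [Nonempty ι] [IsLocalRing A]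
    [∀ i, HenselianLocalRing (S i)] (hdir : Directed (· ≤ ·) S)
    (hunion : ∀ x : A, ∃ i, x ∈ S i) (hloc : ∀ i, IsLocalHom (S i).subtype) :
    HenselianLocalRing A where
  is_henselian f hf a₀ h₁ h₂ := by
    classical
    obtain ⟨i, hi⟩ := exists_finset_subset_of_directed hdir hunion (insert a₀ f.coeffs)
    rw [Finset.coe_insert, Set.insert_subset_iff] at hi
    obtain ⟨ha₀, hfi⟩ := hi
    have := hloc i
    obtain ⟨g, rfl⟩ : ∃ g : (S i)[X], g.map (S i).subtype = f :=
      ⟨f.toSubring (S i) hfi, map_toSubring f (S i) hfi⟩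
    obtain ⟨b, rfl⟩ : ∃ b : S i, (S i).subtype b = a₀ := ⟨⟨a₀, ha₀⟩, rfl⟩
    rw [derivative_map, eval_map_apply] at h₂
    rw [eval_map_apply, mem_maximalIdeal, map_mem_nonunits_iff] at h₁
    obtain ⟨a, ha, hab⟩ := HenselianLocalRing.is_henselian g
      ((S i).subtype_injective.monic_map_iff.mpr hf) b h₁ (isUnit_of_map_unit _ _ h₂)
    refine ⟨(S i).subtype a, ha.map, ?_⟩
    rwa [← map_sub, mem_maximalIdeal, map_mem_nonunits_iff]

end Subring

/-- Let `A` be a commutative ring which is the union of a directed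
family of subrings `(A_i)`, each a henselian local ring, with all inclusions
`A_i → A_j` local homomorphisms.  Then `A` is a henselian local ring whose
maximal ideal is the union of the maximal ideals of the `A_i`. -/
theorem directed_union_of_henselian_local_is_henselian_local
    (A : Type*) [CommRing A] {ι : Type*} [Nonempty ι]
    (Ai : ι → Subring A)
    (hdir : Directed (· ≤ ·) Ai)
    (hunion : ∀ x : A, ∃ i, x ∈ Ai i)
    (hH : ∀ i, HenselianLocalRing (Ai i))
    (hloc : ∀ i j (hij : Ai i ≤ Ai j) (x : Ai i),
      x ∈ @IsLocalRing.maximalIdeal (Ai i) _ (hH i).toIsLocalRing →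
      Subring.inclusion hij x ∈ @IsLocalRing.maximalIdeal (Ai j) _ (hH j).toIsLocalRing) :
    ∃ hA : HenselianLocalRing A,
      (@IsLocalRing.maximalIdeal A _ hA.toIsLocalRing : Set A) =
        ⋃ i, Subtype.val ''
          (@IsLocalRing.maximalIdeal (Ai i) _ (hH i).toIsLocalRing : Set (Ai i)) := by
  have hlocal : ∀ i j (hij : Ai i ≤ Ai j), IsLocalHom (Subring.inclusion hij) := fun i j hij =>
    ⟨fun x hx => by
      by_contra hn
      exact hloc i j hij x hn hx⟩
  have hsub := Subring.isLocalHom_subtype_of_directed hdir hunion hlocal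
  have : IsLocalRing A := Subring.isLocalRing_of_union hunion
  refine ⟨Subring.henselianLocalRing_of_directed hdir hunion hsub, ?_⟩
  ext x
  simp only [SetLike.mem_coe, Set.mem_iUnion, Set.mem_image]
  constructor
  · intro hx
    obtain ⟨i, hi⟩ := hunion x
    exact ⟨i, ⟨x, hi⟩, fun h => hx (h.map (Ai i).subtype), rfl⟩
  · rintro ⟨i, y, hy, rfl⟩ h
    exact hy (isUnit_of_map_unit (Ai i).subtype y h)
end
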